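/- arXiv:math/0209272 — 4 statements merged into one kernel-verified Lean document; each statement's English description precedes it below -/
import Mathlib

section
/- Let n be a positive integer, let M_1 and M_2 be nonnegative integers, and let S be an integer with -M_1 ≤ S ≤ M_2. Then the sum over all integer tuples (k_1,…,k_n) with k_1+⋯+k_n = S and with M_1 + n·k_i + i - 1 ≥ 0 and M_2 - n·k_i + n - i ≥ 0 for all i (a finite sum) of the quantity (-1)^{(n-1)S} · q^{binom(n+1,2)·(k_1²+⋯+k_n²) + (1·k_1+2·k_2+⋯+n·k_n)} · ∏_{1≤i<j≤n} (1 - q^{n·k_j - n·k_i + j - i}) · ∏_{i=1}^{n} (q;q)_{M_1+M_2+i-1} / ( (q;q)_{M_1+n·k_i+i-1} · (q;q)_{M_2-n·k_i+n-i} ) equals q^{(n+1)·binom(S+1,2)} · (q;q)_{M_1+M_2} / ( (q;q)_{M_1+S} · (q;q)_{M_2-S} ). -/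
open Finset

/-- The q-shifted factorial (q-Pochhammer symbol) `(a;q)_k = ∏_{j=0}^{k-1} (1 - a q^j)`. -/
noncomputable def qPoch {F : Type*} [Field F] (q a : F) (k : ℕ) : F :=
  ∏ j ∈ Finset.range k, (1 - a * q ^ j)

namespace CyclicSum

/-- The triangular number `x (x - 1) / 2`, extended to all integers. -/
def tri (x : ℤ) : ℤ := x * (x - 1) / 2

lemma two_mul_tri (x : ℤ) : 2 * tri x = x * (x - 1) :=
  Int.mul_ediv_cancel' (by simpa [mul_comm] using (Int.even_mul_pred_self x).two_dvd)

lemma tri_zero : tri 0 = 0 := by simp [tri]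

lemma tri_succ (x : ℤ) : tri (x + 1) = tri x + x := by
  have h1 := two_mul_tri x
  have h2 := two_mul_tri (x + 1)
  linarith

variable {F : Type*} [Field F] {q : F}

lemma qPoch_succ (k : ℕ) : qPoch q q (k + 1) = qPoch q q k * (1 - q ^ (k + 1)) := by
  rw [qPoch, Finset.prod_range_succ, ← qPoch, pow_succ']

lemma qPoch_ne_zero (hq : ∀ m : ℕ, 0 < m → q ^ m ≠ 1) (k : ℕ) : qPoch q q k ≠ 0 := by
  refine Finset.prod_ne_zero_iff.2 fun j _ => ?_
  rw [← pow_succ', sub_ne_zero]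
  exact (hq _ j.succ_pos).symm

lemma zpow_ne_one (hq : ∀ m : ℕ, 0 < m → q ^ m ≠ 1) {a : ℤ} (ha : a ≠ 0) : q ^ a ≠ 1 := by
  rcases lt_or_gt_of_ne ha with h | h
  · obtain ⟨m, rfl⟩ : ∃ m : ℕ, a = -(m : ℤ) := ⟨a.natAbs, by omega⟩
    rw [zpow_neg, zpow_natCast, Ne, inv_eq_one]
    exact hq m (by omega)
  · lift a to ℕ using h.le
    rw [zpow_natCast]
    exact hq a (by omega)

lemma zpow_injective (hq0 : q ≠ 0) (hq : ∀ m : ℕ, 0 < m → q ^ m ≠ 1) :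
    Function.Injective fun a : ℤ => q ^ a := by
  intro a b h
  by_contra hab
  refine zpow_ne_one hq (sub_ne_zero.2 hab) ?_
  rw [zpow_sub₀ hq0]
  exact (div_eq_one_iff_eq (zpow_ne_zero _ hq0)).2 h

/-- The finite `q`-binomial theorem. -/
lemma qBinomial_sum (hq0 : q ≠ 0) (hq : ∀ m : ℕ, 0 < m → q ^ m ≠ 1) (L : ℕ) (x : F) :
    (∑ h ∈ range (L + 1), (-1) ^ h * q ^ tri h * x ^ h / (qPoch q q h * qPoch q q (L - h))) *
      qPoch q q L = ∏ s ∈ range L, (1 - x * q ^ s) := by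
  induction L with
  | zero => simp [tri_zero, qPoch]
  | succ L ih =>
    rw [Finset.prod_range_succ, ← ih, qPoch_succ, Finset.sum_mul, Finset.sum_mul, Finset.sum_mul]
    have split : ∀ h ∈ range (L + 1 + 1),
        (-1) ^ h * q ^ tri h * x ^ h / (qPoch q q h * qPoch q q (L + 1 - h)) *
          (qPoch q q L * (1 - q ^ (L + 1))) =
        (-1) ^ h * q ^ tri h * x ^ h / (qPoch q q h * qPoch q q (L + 1 - h)) *
          (qPoch q q L * (1 - q ^ (L + 1 - h))) +
        (-1) ^ h * q ^ tri h * x ^ h / (qPoch q q h * qPoch q q (L + 1 - h)) *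
          (qPoch q q L * (q ^ (L + 1 - h) * (1 - q ^ h))) := by
      intro h hh
      have : q ^ (L + 1) = q ^ (L + 1 - h) * q ^ h := by
        rw [← pow_add]; congr 1; have := mem_range.1 hh; omega
      rw [this]; ring
    rw [Finset.sum_congr rfl split, Finset.sum_add_distrib, Finset.sum_range_succ,
      Finset.sum_range_succ' _ (L + 1)]
    simp only [Nat.sub_self, pow_zero, sub_self, mul_zero, add_zero]
    rw [← Finset.sum_add_distrib]
    refine Finset.sum_congr rfl fun h hh => ?_
    have hL : h ≤ L := by have := mem_range.1 hh; omega
    obtain ⟨m, rfl⟩ := Nat.exists_eq_add_of_le hL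
    have e1 : h + m + 1 - h = m + 1 := by omega
    have e2 : h + m + 1 - (h + 1) = m := by omega
    have e3 : h + m - h = m := by omega
    rw [e1, e2, e3, qPoch_succ, qPoch_succ, Nat.cast_add, Nat.cast_one, tri_succ, zpow_add₀ hq0,
      zpow_natCast]
    have h1 := qPoch_ne_zero hq h
    have h2 := qPoch_ne_zero hq m
    have h3 : (1 : F) - q ^ (h + 1) ≠ 0 := sub_ne_zero.2 (hq _ h.succ_pos).symm
    have h4 : (1 : F) - q ^ (m + 1) ≠ 0 := sub_ne_zero.2 (hq _ m.succ_pos).symm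
    field_simp
    ring

lemma qBinomial_sum_eq_zero (hq0 : q ≠ 0) (hq : ∀ m : ℕ, 0 < m → q ^ m ≠ 1) {L s : ℕ}
    (hs : s < L) :
    ∑ h ∈ range (L + 1), (-1) ^ h * q ^ tri h * (q ^ (-(s : ℤ))) ^ h /
      (qPoch q q h * qPoch q q (L - h)) = 0 := by
  have h := qBinomial_sum hq0 hq L (q ^ (-(s : ℤ)))
  rw [Finset.prod_eq_zero (mem_range.2 hs)
    (by rw [zpow_neg, zpow_natCast, inv_mul_cancel₀ (pow_ne_zero _ hq0), sub_self])] at h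
  exact (mul_eq_zero.1 h).resolve_right (qPoch_ne_zero hq L)

lemma det_mul_det_of_annihilating {R ι κ : Type*} [CommRing R] [Fintype ι] [DecidableEq ι]
    [Fintype κ] [DecidableEq κ] (Y₁ : Matrix ι ι R) (Y₂ : Matrix ι κ R) (W : Matrix κ ι R)
    (R₁ : Matrix ι ι R) (R₂ : Matrix κ ι R) (U₁ : Matrix ι κ R) (U₂ : Matrix κ κ R)
    (hYU : Y₁ * U₁ + Y₂ * U₂ = 0) (hWR : W * R₁ + R₂ = 0) :
    (W * U₁ + U₂).det * Y₁.det * R₁.det = (Y₁ * R₁ + Y₂ * R₂).det * U₂.det := by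
  have h1 : (Matrix.fromBlocks Y₁ Y₂ W 1).det * U₂.det = Y₁.det * (W * U₁ + U₂).det := by
    have := congrArg Matrix.det (Matrix.fromBlocks_multiply Y₁ Y₂ W 1 1 U₁ 0 U₂)
    simpa [hYU] using this
  have h2 : (Matrix.fromBlocks Y₁ Y₂ W 1).det * R₁.det = (Y₁ * R₁ + Y₂ * R₂).det := by
    have := congrArg Matrix.det (Matrix.fromBlocks_multiply Y₁ Y₂ W 1 R₁ 0 R₂ 1)
    simpa [hWR] using this
  linear_combination (-R₁.det) * h1 + U₂.det * h2

/-- Labels `0, …, M₁ + M₂ - 1`, split into two consecutive blocks. -/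
def node {M₁ M₂ : ℕ} : Fin M₁ ⊕ Fin M₂ → ℕ :=
  Sum.elim (fun j => j) (fun j => M₁ + j)

/-- The labels `node`, with the second block moved up by `d`. -/
def gapNode (d : ℕ) {M₁ M₂ : ℕ} : Fin M₁ ⊕ Fin M₂ → ℕ :=
  Sum.elim (fun j => j) (fun j => M₁ + d + j)

lemma node_lt {M₁ M₂ : ℕ} (j : Fin M₁ ⊕ Fin M₂) : node j < M₁ + M₂ := by
  rcases j with j | j <;> simp [node]
  omega

lemma sum_gapNode_add_sum {A : Type*} [AddCommMonoid A] (d M₁ M₂ : ℕ) (f : ℕ → A) :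
    (∑ a : Fin M₁ ⊕ Fin M₂, f (gapNode d a)) + ∑ i : Fin d, f (M₁ + i) =
      ∑ h ∈ range (M₁ + M₂ + d), f h := by
  have e : M₁ + M₂ + d = M₁ + d + M₂ := by omega
  rw [e, Finset.sum_range_add, Finset.sum_range_add, Fintype.sum_sum_type]
  simp only [gapNode, Sum.elim_inl, Sum.elim_inr, Finset.sum_range]
  abel

variable {d M₁ M₂ : ℕ} {y r : F}

/-- Solution of `w (h + d) = y * r ^ h * w h` along `h = M₁ + i + d * k`, normalized by
the value `1` at `k = 0`. -/
def runnerValue (d M₁ : ℕ) (y r : F) (i : ℕ) (k : ℤ) : F :=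
  y ^ k * r ^ (k * (M₁ + i) + d * tri k)

/-- The sequence with values `runnerValue` on the residue class of `M₁ + i`, and zero elsewhere. -/
noncomputable def runner (d M₁ : ℕ) (y r : F) (i h : ℕ) : F :=
  if (d : ℤ) ∣ h - (M₁ + i) then runnerValue d M₁ y r i ((h - (M₁ + i)) / d) else 0

lemma runner_add (hd : 0 < d) (hy : y ≠ 0) (hr : r ≠ 0) (i h : ℕ) :
    runner d M₁ y r i (h + d) = y * r ^ h * runner d M₁ y r i h := by
  unfold runner
  have e : ((h + d : ℕ) : ℤ) - (M₁ + i) = h - (M₁ + i) + d := by push_cast; ring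
  rw [e]
  by_cases hdvd : (d : ℤ) ∣ h - (M₁ + i)
  · obtain ⟨k, hk⟩ := hdvd
    have hd' : (d : ℤ) ≠ 0 := by omega
    have h1 : (h : ℤ) - (M₁ + i) + d = d * (k + 1) := by rw [hk]; ring
    rw [h1, hk, if_pos (dvd_mul_right _ _), if_pos (dvd_mul_right _ _),
      Int.mul_ediv_cancel_left _ hd', Int.mul_ediv_cancel_left _ hd', runnerValue, runnerValue,
      zpow_add_one₀ hy, tri_succ, ← zpow_natCast r h]
    have h2 : (k + 1) * ((M₁ : ℤ) + i) + d * (tri k + k) = h + (k * (M₁ + i) + d * tri k) := by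
      linear_combination -hk
    rw [h2, zpow_add₀ hr]
    ring
  · rw [if_neg, if_neg hdvd, mul_zero]
    rwa [Int.dvd_add_left (dvd_refl _)]

lemma runner_mid (i j : Fin d) : runner d M₁ y r i (M₁ + j) = if i = j then 1 else 0 := by
  unfold runner
  have e : ((M₁ + j : ℕ) : ℤ) - (M₁ + (i : ℕ)) = (j : ℕ) - (i : ℕ) := by push_cast; ring
  rw [e]
  by_cases h : i = j
  · simp [h, runnerValue, tri_zero]
  · rw [if_neg h, if_neg]
    intro hdvd
    have hi := i.isLt
    have hj := j.isLt
    have := Int.eq_zero_of_abs_lt_dvd hdvd (by rw [abs_lt]; omega)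
    exact h (Fin.ext (by omega))

/-- Coefficients annihilating geometric sequences, in the variable `h`. -/
noncomputable def binCoeff (q : F) (N L : ℕ) (h : ℤ) : F :=
  if 0 ≤ h ∧ h ≤ L then
    (-1) ^ h * q ^ (tri h - h * (N - 1)) / (qPoch q q h.toNat * qPoch q q (L - h).toNat)
  else 0

lemma sum_pow_mul_binCoeff (hq0 : q ≠ 0) (hq : ∀ m : ℕ, 0 < m → q ^ m ≠ 1) {N d L : ℕ}
    (hL : L + 1 = N + d) {m c : ℕ} (hm : m < N) (hc : c < d) :
    ∑ h ∈ range (N + d), q ^ (m * h) * (binCoeff q N L h * (q ^ (-(h : ℤ))) ^ c) = 0 := by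
  rw [← qBinomial_sum_eq_zero hq0 hq (L := L) (s := N - 1 + c - m) (by omega), hL]
  refine Finset.sum_congr rfl fun h hh => ?_
  have hhL : h ≤ L := by have := mem_range.1 hh; omega
  rw [binCoeff, if_pos ⟨by omega, by omega⟩, zpow_natCast, Int.toNat_natCast,
    show ((L : ℤ) - h).toNat = L - h by omega, ← zpow_natCast q (m * h), ← zpow_natCast _ c,
    ← zpow_natCast (q ^ (-((N - 1 + c - m : ℕ) : ℤ))) h, ← zpow_mul, ← zpow_mul,
    div_mul_eq_mul_div, mul_div_assoc']
  congr 1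
  have e : ((m * h : ℕ) : ℤ) + (tri h - h * (N - 1) + -(h : ℤ) * c) =
      tri h + -((N - 1 + c - m : ℕ) : ℤ) * h := by
    have : ((N - 1 + c - m : ℕ) : ℤ) = N - 1 + c - m := by omega
    rw [this]; push_cast; ring
  calc _ = (-1) ^ h * (q ^ ((m * h : ℕ) : ℤ) *
        (q ^ (tri h - h * (N - 1)) * q ^ (-(h : ℤ) * c))) := by ring
    _ = _ := by rw [← zpow_add₀ hq0, ← zpow_add₀ hq0, e, zpow_add₀ hq0]; ring

lemma mem_box {i : ℕ} (hi : i < d) {k : ℤ} (h1 : 0 ≤ (M₁ : ℤ) + d * k + i)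
    (h2 : 0 ≤ (M₂ : ℤ) - d * k + d - (i + 1)) : k ∈ Icc (-(M₁ : ℤ)) M₂ := by
  rw [mem_Icc]
  constructor
  · by_contra hlt
    have : (d : ℤ) * k ≤ d * (-M₁ - 1) := mul_le_mul_of_nonneg_left (by omega) (by omega)
    nlinarith
  · by_contra hlt
    have : (d : ℤ) * (M₂ + 1) ≤ d * k := mul_le_mul_of_nonneg_left (by omega) (by omega)
    nlinarith

/-- A sum over the values of a runner is a sum over the runner positions. -/
lemma sum_runner_mul {L : ℕ} (hd : 0 < d) (hL : L + 1 = M₁ + M₂ + d) (i : Fin d) (f : ℤ → F)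
    (hf : ∀ h : ℤ, ¬ (0 ≤ h ∧ h ≤ L) → f h = 0) :
    ∑ h ∈ range (M₁ + M₂ + d), runner d M₁ y r i h * f h =
      ∑ k ∈ Icc (-(M₁ : ℤ)) M₂, runnerValue d M₁ y r i k * f (M₁ + i + d * k) := by
  have hd' : (d : ℤ) ≠ 0 := by omega
  have hi := i.isLt
  refine (Finset.sum_bij_ne_zero (fun k _ _ => ((M₁ : ℤ) + i + d * k).toNat) ?_ ?_ ?_ ?_).symm
  · intro k _ hk
    by_cases h : 0 ≤ (M₁ : ℤ) + i + d * k ∧ (M₁ : ℤ) + i + d * k ≤ L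
    · rw [mem_range]; omega
    · rw [hf _ h, mul_zero] at hk; exact absurd rfl hk
  · intro k _ hk k' _ hk' he
    by_cases h : 0 ≤ (M₁ : ℤ) + i + d * k ∧ (M₁ : ℤ) + i + d * k ≤ L
    · by_cases h' : 0 ≤ (M₁ : ℤ) + i + d * k' ∧ (M₁ : ℤ) + i + d * k' ≤ L
      · exact mul_left_cancel₀ hd' (by omega)
      · rw [hf _ h', mul_zero] at hk'; exact absurd rfl hk'
    · rw [hf _ h, mul_zero] at hk; exact absurd rfl hk
  · intro h hh hne
    have hdvd : (d : ℤ) ∣ h - (M₁ + (i : ℕ)) := by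
      by_contra hc
      simp [runner, hc] at hne
    obtain ⟨k, hk⟩ := hdvd
    have hval : (M₁ : ℤ) + i + d * k = h := by linarith
    have hh' := mem_range.1 hh
    refine ⟨k, mem_box hi (by omega) (by omega), ?_, by rw [hval]; simp⟩
    · rw [hval]
      have hr : runner d M₁ y r i h = runnerValue d M₁ y r i k := by
        rw [runner, if_pos ⟨k, hk⟩, hk, Int.mul_ediv_cancel_left _ hd']
      rwa [← hr]
  · intro k _ hk
    by_cases h : 0 ≤ (M₁ : ℤ) + i + d * k ∧ (M₁ : ℤ) + i + d * k ≤ L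
    · have hc : (((M₁ : ℤ) + i + d * k).toNat : ℤ) = M₁ + i + d * k := Int.toNat_of_nonneg h.1
      rw [runner, hc, show (M₁ : ℤ) + i + d * k - (M₁ + (i : ℕ)) = d * k by ring,
        if_pos (dvd_mul_right _ _), Int.mul_ediv_cancel_left _ hd']
    · rw [hf _ h, mul_zero] at hk; exact absurd rfl hk

/-- Summand of the expanded determinant attached to `k`. -/
noncomputable def summand (q : F) (d M₁ M₂ L : ℕ) (y r : F) (k : Fin d → ℤ) : F :=
  (∏ i : Fin d, runnerValue d M₁ y r i (k i) * binCoeff q (M₁ + M₂) L (M₁ + i + d * k i)) *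
    (Matrix.vandermonde fun i : Fin d => q ^ (-((M₁ : ℤ) + i + d * k i))).det

lemma det_sum_runner (L : ℕ) (s : Finset ℤ) :
    (Matrix.of fun i c : Fin d => ∑ k ∈ s, runnerValue d M₁ y r i k *
      (binCoeff q (M₁ + M₂) L (M₁ + i + d * k) * (q ^ (-((M₁ : ℤ) + i + d * k))) ^ (c : ℕ))).det =
    ∑ k ∈ Fintype.piFinset fun _ : Fin d => s, summand q d M₁ M₂ L y r k := by
  have h := (Matrix.detRowAlternating (n := Fin d) (R := F)).toMultilinearMap.map_sum_finset
    (fun i k => fun c : Fin d => runnerValue d M₁ y r i k *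
      (binCoeff q (M₁ + M₂) L (M₁ + i + d * k) * (q ^ (-((M₁ : ℤ) + i + d * k))) ^ (c : ℕ)))
    (fun _ => s)
  have e : (Matrix.of fun i c : Fin d => ∑ k ∈ s, runnerValue d M₁ y r i k *
      (binCoeff q (M₁ + M₂) L (M₁ + i + d * k) * (q ^ (-((M₁ : ℤ) + i + d * k))) ^ (c : ℕ))) =
      Matrix.of fun i : Fin d => ∑ k ∈ s, fun c : Fin d => runnerValue d M₁ y r i k *
      (binCoeff q (M₁ + M₂) L (M₁ + i + d * k) * (q ^ (-((M₁ : ℤ) + i + d * k))) ^ (c : ℕ)) := by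
    ext i c
    simp [Finset.sum_apply]
  rw [e]
  refine h.trans (Finset.sum_congr rfl fun k _ => ?_)
  rw [summand, ← Matrix.det_mul_column]
  change Matrix.det _ = _
  congr 1
  ext i c
  simp [Matrix.vandermonde_apply, mul_assoc]

/-- Entries of the operator `f h ↦ f (h - d) - y * r ^ h * f h` between the labels `gapNode`
and `node`. -/
noncomputable def shiftBlock (d : ℕ) (y r : F) : Matrix (Fin M₁ ⊕ Fin M₂) (Fin M₁ ⊕ Fin M₂) F :=
  Matrix.of fun a j =>
    (if gapNode d a = node j + d then (1 : F) else 0) -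
      if gapNode d a = node j then y * r ^ node j else 0

lemma shiftBlock_eq_zero {a j : Fin M₁ ⊕ Fin M₂} (h1 : gapNode d a ≠ node j + d)
    (h2 : gapNode d a ≠ node j) : shiftBlock d y r a j = 0 := by
  rw [shiftBlock, Matrix.of_apply, if_neg h1, if_neg h2, sub_zero]

lemma det_shiftBlock (hd : 0 < d) (y r : F) :
    (shiftBlock d y r : Matrix (Fin M₁ ⊕ Fin M₂) _ F).det =
      (-y) ^ M₁ * r ^ (∑ j ∈ range M₁, j) := by
  rw [← Matrix.fromBlocks_toBlocks (shiftBlock d y r),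
    show Matrix.toBlocks₁₂ (shiftBlock d y r : Matrix (Fin M₁ ⊕ Fin M₂) _ F) = 0 from ?_,
    Matrix.det_fromBlocks_zero₁₂, Matrix.det_of_isLowerTriangular, Matrix.det_of_isUpperTriangular]
  · have h1 : ∀ j : Fin M₁, (shiftBlock d y r : Matrix (Fin M₁ ⊕ Fin M₂) _ F).toBlocks₁₁ j j =
        -y * r ^ (j : ℕ) := fun j => by
      rw [Matrix.toBlocks₁₁, Matrix.of_apply, shiftBlock, Matrix.of_apply,
        if_neg (by simp [gapNode, node]; omega), if_pos (by simp [gapNode, node])]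
      simp [node]
    have h2 : ∀ j : Fin M₂, (shiftBlock d y r : Matrix (Fin M₁ ⊕ Fin M₂) _ F).toBlocks₂₂ j j =
        1 := fun j => by
      rw [Matrix.toBlocks₂₂, Matrix.of_apply, shiftBlock, Matrix.of_apply,
        if_pos (by simp [gapNode, node]; omega), if_neg (by simp [gapNode, node]; omega), sub_zero]
    simp only [h1, h2, Finset.prod_const_one, mul_one]
    rw [← Finset.prod_range fun j => -y * r ^ j, ← Finset.prod_pow_eq_pow_sum,
      Finset.prod_mul_distrib]
    simp
  · intro i j hij
    have hij' : (j : ℕ) < i := hij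
    exact shiftBlock_eq_zero (by simp [gapNode, node]; omega) (by simp [gapNode, node]; omega)
  · intro i j hij
    have hij' : (i : ℕ) < j := hij
    exact shiftBlock_eq_zero (by simp [gapNode, node]; omega) (by simp [gapNode, node]; omega)
  · ext i j
    have hi := i.isLt
    exact shiftBlock_eq_zero (by simp [gapNode, node]; omega) (by simp [gapNode, node]; omega)

lemma sum_summand_mul_det (hq0 : q ≠ 0) (hq : ∀ m : ℕ, 0 < m → q ^ m ≠ 1) (hd : 0 < d)
    {L : ℕ} (hL : L + 1 = M₁ + M₂ + d) (hy : y ≠ 0) (hr : r ≠ 0) :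
    (∑ k ∈ Fintype.piFinset fun _ : Fin d => Icc (-(M₁ : ℤ)) M₂, summand q d M₁ M₂ L y r k) *
      (Matrix.of fun i a : Fin M₁ ⊕ Fin M₂ => q ^ (node i * gapNode d a)).det *
      ((-y) ^ M₁ * r ^ (∑ j ∈ range M₁, j)) =
    (Matrix.of fun i j : Fin M₁ ⊕ Fin M₂ =>
      q ^ (node i * node j) * (q ^ (node i * d) - y * r ^ node j)).det *
      summand q d M₁ M₂ L y r 0 := by
  have key := det_mul_det_of_annihilating
    (Matrix.of fun i a : Fin M₁ ⊕ Fin M₂ => q ^ (node i * gapNode d a))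
    (Matrix.of fun (i : Fin M₁ ⊕ Fin M₂) (a : Fin d) => q ^ (node i * (M₁ + a)))
    (Matrix.of fun (i : Fin d) (a : Fin M₁ ⊕ Fin M₂) => runner d M₁ y r i (gapNode d a))
    (shiftBlock d y r)
    (Matrix.of fun (a : Fin d) (j : Fin M₁ ⊕ Fin M₂) =>
      (if M₁ + a = node j + d then (1 : F) else 0) -
        if M₁ + a = node j then y * r ^ node j else 0)
    (Matrix.of fun (a : Fin M₁ ⊕ Fin M₂) (c : Fin d) =>
      binCoeff q (M₁ + M₂) L (gapNode d a : ℕ) * (q ^ (-((gapNode d a : ℕ) : ℤ))) ^ (c : ℕ))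
    (Matrix.of fun (a c : Fin d) =>
      binCoeff q (M₁ + M₂) L ((M₁ + a : ℕ) : ℤ) * (q ^ (-((M₁ + a : ℕ) : ℤ))) ^ (c : ℕ))
    ?_ ?_
  · rw [det_shiftBlock hd] at key
    convert key using 2
    · congr 1
      rw [← det_sum_runner]
      congr 1
      ext i c
      have hf := sum_runner_mul hd hL i (y := y) (r := r)
        (fun h => binCoeff q (M₁ + M₂) L h * (q ^ (-h)) ^ (c : ℕ))
        (fun h hh => by rw [binCoeff, if_neg hh, zero_mul])
      rw [Matrix.of_apply, ← hf, ← sum_gapNode_add_sum]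
      simp only [Matrix.add_apply, Matrix.mul_apply, Matrix.of_apply]
      congr 1
      simp only [runner_mid, ite_mul, one_mul, zero_mul, Finset.sum_ite_eq, Finset.mem_univ,
        if_true]
    · congr 1
      ext i j
      simp only [Matrix.add_apply, Matrix.mul_apply, Matrix.of_apply, shiftBlock]
      rw [sum_gapNode_add_sum d M₁ M₂ fun h => q ^ (node i * h) *
        ((if h = node j + d then (1 : F) else 0) - if h = node j then y * r ^ node j else 0)]
      have hj := node_lt j
      simp only [mul_sub, mul_ite, mul_one, mul_zero, Finset.sum_sub_distrib,
        Finset.sum_ite_eq', mem_range]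
      rw [if_pos (by omega), if_pos (by omega)]
      ring
    · rw [summand, ← Matrix.det_mul_column]
      congr 1
      ext i c
      simp [runnerValue, tri_zero, Matrix.vandermonde_apply]
  · ext i c
    simp only [Matrix.add_apply, Matrix.mul_apply, Matrix.of_apply, Matrix.zero_apply]
    rw [sum_gapNode_add_sum d M₁ M₂ fun h => q ^ (node i * h) *
      (binCoeff q (M₁ + M₂) L (h : ℕ) * (q ^ (-(h : ℤ))) ^ (c : ℕ))]
    exact sum_pow_mul_binCoeff hq0 hq hL (node_lt i) c.isLt
  · ext i j
    simp only [Matrix.add_apply, Matrix.mul_apply, Matrix.of_apply, shiftBlock, Matrix.zero_apply]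
    have hmid : (if M₁ + (i : ℕ) = node j + d then (1 : F) else 0) -
        (if M₁ + (i : ℕ) = node j then y * r ^ node j else 0) =
        ∑ a : Fin d, runner d M₁ y r i (M₁ + a) *
          ((if M₁ + (a : ℕ) = node j + d then (1 : F) else 0) -
            if M₁ + (a : ℕ) = node j then y * r ^ node j else 0) := by
      simp only [runner_mid, ite_mul, one_mul, zero_mul, Finset.sum_ite_eq, Finset.mem_univ,
        if_true]
    rw [hmid, sum_gapNode_add_sum d M₁ M₂ fun h => runner d M₁ y r i h *
        ((if h = node j + d then (1 : F) else 0) - if h = node j then y * r ^ node j else 0)]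
    have hj := node_lt j
    simp only [mul_sub, mul_ite, mul_one, mul_zero, Finset.sum_sub_distrib,
      Finset.sum_ite_eq', mem_range]
    rw [if_pos (by omega), if_pos (by omega), runner_add hd hy hr]
    ring

lemma tri_add (a b : ℤ) : tri (a + b) = tri a + tri b + a * b := by
  have h1 := two_mul_tri a
  have h2 := two_mul_tri b
  have h3 := two_mul_tri (a + b)
  linarith

lemma prod_Ioi_eq_prod_filter {N : ℕ} (f : Fin N → Fin N → F) :
    ∏ i, ∏ j ∈ Finset.Ioi i, f i j = ∏ j, ∏ i ∈ univ.filter (· < j), f i j :=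
  Finset.prod_comm' (by simp)

lemma prod_filter_eq_prod_range {N : ℕ} (f : ℕ → ℕ → F) :
    ∏ j : Fin N, ∏ i ∈ univ.filter (· < j), f i j = ∏ j ∈ range N, ∏ i ∈ range j, f i j := by
  rw [Finset.prod_range]
  refine Finset.prod_congr rfl fun j _ => ?_
  rw [← Nat.Iio_eq_range, ← Fin.map_valEmbedding_Iio, Finset.prod_map]
  refine Finset.prod_congr ?_ fun _ _ => rfl
  ext i
  simp

/-- Reciprocal of a `q`-binomial denominator, zero outside the natural range. -/
noncomputable def recipWeight (q : F) (L : ℕ) (h : ℤ) : F :=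
  if 0 ≤ h ∧ h ≤ L then 1 / (qPoch q q h.toNat * qPoch q q (L - h).toNat) else 0

/-- The product part of the summand, without powers of `q`, `r` and `y`. -/
noncomputable def weight (q : F) (d M₁ L : ℕ) (k : Fin d → ℤ) : F :=
  (∏ i : Fin d, recipWeight q L (M₁ + i + d * k i)) *
    ∏ j : Fin d, ∏ i ∈ univ.filter (· < j), (1 - q ^ (d * k j - d * k i + (j : ℕ) - (i : ℕ)))

/-- The monomial in `q` and `r` that `summand` attaches to the component `k` with index `i`,
normalized by its value at `k = 0`. -/
noncomputable def phase (q r : F) (d M₁ N : ℕ) (i : ℕ) (k : ℤ) : F :=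
  r ^ (k * (M₁ + i) + d * tri k) *
    ((-1) ^ (d * k) * q ^ (d * k * (M₁ + i) + tri (d * k) - d * k * (N - 1 + i)))

lemma det_vandermonde_eq (hq0 : q ≠ 0) (k : Fin d → ℤ) :
    (Matrix.vandermonde fun i : Fin d => q ^ (-((M₁ : ℤ) + i + d * k i))).det =
      (∏ i : Fin d, q ^ (-(((M₁ : ℤ) + i + d * k i) * i))) *
        ∏ j : Fin d, ∏ i ∈ univ.filter (· < j),
          (1 - q ^ (d * k j - d * k i + (j : ℕ) - (i : ℕ))) := by
  rw [Matrix.det_vandermonde, prod_Ioi_eq_prod_filter, ← Finset.prod_mul_distrib]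
  refine Finset.prod_congr rfl fun j _ => ?_
  have hcard : (univ.filter (· < j)).card = (j : ℕ) := by
    rw [← Fin.card_Iio j]; congr 1; ext i; simp
  rw [← neg_mul, zpow_mul, zpow_natCast, ← hcard, ← Finset.prod_const, ← Finset.prod_mul_distrib]
  refine Finset.prod_congr rfl fun i _ => ?_
  rw [mul_sub, mul_one, ← zpow_add₀ hq0]
  congr 2
  ring

lemma summand_eq (hq0 : q ≠ 0) (hr : r ≠ 0) (L : ℕ) (k : Fin d → ℤ) :
    summand q d M₁ M₂ L y r k =
      (∏ i : Fin d, (-1) ^ ((M₁ : ℤ) + i) *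
        q ^ (tri (M₁ + i) - (M₁ + i) * (((M₁ + M₂ : ℕ) : ℤ) - 1 + i))) *
      ((∏ i : Fin d, y ^ k i * phase q r d M₁ (M₁ + M₂) i (k i)) * weight q d M₁ L k) := by
  rw [summand, det_vandermonde_eq hq0, weight]
  simp only [← mul_assoc]
  congr 1
  simp only [← Finset.prod_mul_distrib]
  refine Finset.prod_congr rfl fun i _ => ?_
  rw [binCoeff, recipWeight, runnerValue, phase]
  split_ifs with h
  · rw [tri_add, zpow_add₀ (by simp : (-1 : F) ≠ 0) (M₁ + (i : ℕ)),
      show tri ((M₁ : ℤ) + i) + tri (d * k i) + (M₁ + i) * (d * k i) -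
        (M₁ + i + d * k i) * (((M₁ + M₂ : ℕ) : ℤ) - 1) =
        (tri ((M₁ : ℤ) + i) - (M₁ + i) * (((M₁ + M₂ : ℕ) : ℤ) - 1 + i)) +
        (d * k i * (M₁ + i) + tri (d * k i) - d * k i * (((M₁ + M₂ : ℕ) : ℤ) - 1 + i)) +
        (M₁ + i + d * k i) * i by ring,
      zpow_add₀ hq0, zpow_add₀ hq0, zpow_neg]
    have := zpow_ne_zero ((M₁ + i + d * k i) * i) hq0
    field_simp
  · simp

lemma prod_range_one_sub_pow_sub (j : ℕ) : ∏ i ∈ range j, (1 - q ^ (j - i)) = qPoch q q j := by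
  rw [qPoch, ← Finset.prod_range_reflect]
  refine Finset.prod_congr rfl fun i hi => ?_
  have := mem_range.1 hi
  rw [← pow_succ']
  congr 2
  omega

lemma weight_zero {L : ℕ} (hL : L + 1 = M₁ + M₂ + d) :
    weight q d M₁ L 0 =
      ∏ i ∈ range d, qPoch q q i / (qPoch q q (M₁ + i) * qPoch q q (M₂ + i)) := by
  rw [weight, Finset.prod_div_distrib, div_eq_inv_mul]
  congr 1
  · rw [Finset.prod_mul_distrib, ← Finset.prod_range_reflect (fun i => qPoch q q (M₂ + i)),
      ← Finset.prod_mul_distrib, ← Finset.prod_inv_distrib, Finset.prod_range]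
    refine Finset.prod_congr rfl fun i _ => ?_
    have := i.isLt
    simp only [Pi.zero_apply, mul_zero, add_zero]
    rw [recipWeight, if_pos (by omega), one_div, show ((M₁ : ℤ) + i).toNat = M₁ + i by omega,
      show ((L : ℤ) - (M₁ + i)).toNat = M₂ + (d - 1 - i) by omega]
  · rw [← Finset.prod_congr rfl fun j _ => prod_range_one_sub_pow_sub (q := q) j,
      ← prod_filter_eq_prod_range fun i j => 1 - q ^ (j - i)]
    refine Finset.prod_congr rfl fun j _ => Finset.prod_congr rfl fun i hi => ?_
    have hij : (i : ℕ) < j := (Finset.mem_filter.1 hi).2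
    rw [← zpow_natCast, Nat.cast_sub hij.le]
    simp

lemma weight_zero_ne_zero (hq : ∀ m : ℕ, 0 < m → q ^ m ≠ 1) {L : ℕ}
    (hL : L + 1 = M₁ + M₂ + d) : weight q d M₁ L 0 ≠ 0 := by
  rw [weight_zero hL]
  exact Finset.prod_ne_zero_iff.2 fun i _ => div_ne_zero (qPoch_ne_zero hq _)
    (mul_ne_zero (qPoch_ne_zero hq _) (qPoch_ne_zero hq _))

lemma det_gapNode :
    (Matrix.of fun i a : Fin M₁ ⊕ Fin M₂ => q ^ (node i * gapNode d a)).det =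
      ∏ b ∈ range (M₁ + M₂), ∏ a ∈ range b,
        (q ^ (if b < M₁ then b else b + d) - q ^ (if a < M₁ then a else a + d)) := by
  rw [← prod_filter_eq_prod_range fun a b =>
      q ^ (if b < M₁ then b else b + d) - q ^ (if a < M₁ then a else a + d),
    ← prod_Ioi_eq_prod_filter fun a b : Fin (M₁ + M₂) =>
      q ^ (if (b : ℕ) < M₁ then (b : ℕ) else b + d) - q ^ (if (a : ℕ) < M₁ then (a : ℕ) else a + d),
    ← Matrix.det_vandermonde fun a : Fin (M₁ + M₂) => q ^ (if (a : ℕ) < M₁ then (a : ℕ) else a + d),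
    ← Matrix.det_transpose, ← Matrix.det_reindex_self finSumFinEquiv.symm]
  congr 1
  ext a i
  rw [Matrix.transpose_apply, Matrix.of_apply, Matrix.reindex_apply, Matrix.submatrix_apply,
    Matrix.vandermonde_apply, Equiv.symm_symm, ← pow_mul, mul_comm]
  congr 2
  · rcases a with a | a
    · simp [gapNode]
    · simp [gapNode]; omega
  · rcases i with i | i <;> simp [node]

lemma prod_sub_gap (hq : ∀ m : ℕ, 0 < m → q ^ m ≠ 1) (d M₁ M₂ : ℕ) :
    ∏ a ∈ range (M₁ + M₂), (q ^ (M₁ + M₂ + d) - q ^ (if a < M₁ then a else a + d)) =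
      (∏ a ∈ range (M₁ + M₂), -q ^ a) * q ^ (d * M₂) * qPoch q q (M₁ + M₂ + d) *
        (qPoch q q M₂ / qPoch q q (M₂ + d)) := by
  have low : ∏ a ∈ range M₁, (q ^ (M₁ + M₂ + d) - q ^ (if a < M₁ then a else a + d)) =
      (∏ a ∈ range M₁, -q ^ a) * ∏ a ∈ range M₁, (1 - q ^ (M₁ + (M₂ + d) - a)) := by
    rw [← Finset.prod_mul_distrib]
    refine Finset.prod_congr rfl fun a ha => ?_
    have ha' := mem_range.1 ha
    have e : M₁ + M₂ + d = a + (M₁ + (M₂ + d) - a) := by omega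
    rw [if_pos ha', e, pow_add]
    ring
  have high : ∏ a ∈ range M₂,
      (q ^ (M₁ + M₂ + d) - q ^ (if M₁ + a < M₁ then M₁ + a else M₁ + a + d)) =
      (∏ a ∈ range M₂, -q ^ (M₁ + a)) * (q ^ (d * M₂) * qPoch q q M₂) := by
    rw [pow_mul, ← prod_range_one_sub_pow_sub, ← Finset.card_range M₂, ← Finset.prod_const,
      Finset.card_range, ← Finset.prod_mul_distrib, ← Finset.prod_mul_distrib]
    refine Finset.prod_congr rfl fun a ha => ?_
    have ha' := mem_range.1 ha
    have e : M₁ + M₂ + d = M₁ + a + d + (M₂ - a) := by omega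
    rw [if_neg (by omega), e, pow_add, pow_add q (M₁ + a) d]
    ring
  have split : (∏ a ∈ range M₁, (1 - q ^ (M₁ + (M₂ + d) - a))) * qPoch q q (M₂ + d) =
      qPoch q q (M₁ + (M₂ + d)) := by
    rw [← prod_range_one_sub_pow_sub (M₁ + (M₂ + d)), Finset.prod_range_add,
      ← prod_range_one_sub_pow_sub (M₂ + d)]
    simp only [Nat.add_sub_add_left]
  rw [Finset.prod_range_add, low, high, Finset.prod_range_add, add_assoc M₁, ← split]
  have := qPoch_ne_zero hq (M₂ + d)
  field_simp

lemma prod_div_qPoch_succ (hq : ∀ m : ℕ, 0 < m → q ^ m ≠ 1) (d M₁ M₂ : ℕ) :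
    qPoch q q M₂ / qPoch q q (M₂ + d) *
      (∏ i ∈ range d, qPoch q q i / (qPoch q q (M₁ + i) * qPoch q q (M₂ + i))) =
    ∏ i ∈ range d, qPoch q q i / (qPoch q q (M₁ + i) * qPoch q q (M₂ + 1 + i)) := by
  have hne := qPoch_ne_zero hq
  induction d with
  | zero => simp [hne]
  | succ d ih =>
    have e : M₂ + 1 + d = M₂ + (d + 1) := by omega
    rw [Finset.prod_range_succ, Finset.prod_range_succ, ← ih, e]
    have h1 := hne (M₂ + d)
    have h2 := hne (M₂ + (d + 1))
    have h3 := hne (M₁ + d)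
    field_simp

lemma det_gapNode_eq (hq : ∀ m : ℕ, 0 < m → q ^ m ≠ 1) {L : ℕ} (hL : L + 1 = M₁ + M₂ + d) :
    (Matrix.of fun i a : Fin M₁ ⊕ Fin M₂ => q ^ (node i * gapNode d a)).det =
      (∏ b ∈ range (M₁ + M₂), ∏ a ∈ range b, -q ^ a) * q ^ (d * ∑ j ∈ range M₂, j) *
        (∏ a ∈ range (M₁ + M₂ + d), qPoch q q a) * weight q d M₁ L 0 := by
  rw [det_gapNode, weight_zero hL]
  clear hL L
  have hne := qPoch_ne_zero hq
  induction M₂ with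
  | zero =>
    rw [add_zero, Finset.prod_range_add, Finset.prod_div_distrib, Finset.prod_mul_distrib]
    have h1 := Finset.prod_ne_zero_iff.2 fun i (_ : i ∈ range d) => hne (M₁ + i)
    have h2 := Finset.prod_ne_zero_iff.2 fun i (_ : i ∈ range d) => hne i
    simp only [Finset.range_zero, Finset.sum_empty, mul_zero, pow_zero, mul_one, zero_add]
    field_simp
    rw [← Finset.prod_mul_distrib]
    refine Finset.prod_congr rfl fun b hb => ?_
    have hb' := mem_range.1 hb
    rw [← prod_range_one_sub_pow_sub, ← Finset.prod_mul_distrib]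
    refine Finset.prod_congr rfl fun a ha => ?_
    have ha' := mem_range.1 ha
    rw [if_pos hb', if_pos (by omega)]
    conv_lhs => rw [show b = a + (b - a) by omega, pow_add]
    ring
  | succ M₂ ih =>
    have e1 : M₁ + (M₂ + 1) = M₁ + M₂ + 1 := by omega
    have e2 : M₁ + M₂ + 1 + d = M₁ + M₂ + d + 1 := by omega
    rw [e1, Finset.prod_range_succ, ih, if_neg (by omega), prod_sub_gap hq,
      ← prod_div_qPoch_succ hq, e2,
      Finset.prod_range_succ (fun b => ∏ a ∈ range b, -q ^ a),
      Finset.prod_range_succ (fun a => qPoch q q a), Finset.sum_range_succ, mul_add, pow_add]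
    ring

lemma sum_phase_mul_weight (hq0 : q ≠ 0) (hq : ∀ m : ℕ, 0 < m → q ^ m ≠ 1) (hd : 0 < d)
    {L N : ℕ} (hN : M₁ + M₂ = N) (hL : L + 1 = N + d) (hy : y ≠ 0) (hr : r ≠ 0) :
    (∑ k ∈ Fintype.piFinset fun _ : Fin d => Icc (-(M₁ : ℤ)) M₂,
        (∏ i : Fin d, y ^ k i * phase q r d M₁ N i (k i)) * weight q d M₁ L k) *
      ((∏ b ∈ range N, ∏ a ∈ range b, -q ^ a) * q ^ (d * ∑ j ∈ range M₂, j) *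
        ∏ a ∈ range (N + d), qPoch q q a) * ((-y) ^ M₁ * r ^ (∑ j ∈ range M₁, j)) =
    (Matrix.of fun i j : Fin N =>
      q ^ ((i : ℕ) * j) * (q ^ ((i : ℕ) * d) - y * r ^ (j : ℕ))).det := by
  subst hN
  have key := sum_summand_mul_det hq0 hq hd hL hy hr
  simp only [summand_eq hq0 hr, ← Finset.mul_sum] at key
  rw [det_gapNode_eq hq hL] at key
  have hdet : (Matrix.of fun i j : Fin M₁ ⊕ Fin M₂ =>
      q ^ (node i * node j) * (q ^ (node i * d) - y * r ^ node j)).det =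
      (Matrix.of fun i j : Fin (M₁ + M₂) =>
        q ^ ((i : ℕ) * j) * (q ^ ((i : ℕ) * d) - y * r ^ (j : ℕ))).det := by
    have hnode : ∀ i : Fin M₁ ⊕ Fin M₂, node i = (finSumFinEquiv i : ℕ) := by
      rintro (i | i) <;> simp [node]
    rw [← Matrix.det_reindex_self finSumFinEquiv.symm]
    congr 1
    ext i j
    simp [hnode]
  rw [hdet] at key
  have hw := weight_zero_ne_zero hq hL
  have hc : (∏ i : Fin d, (-1) ^ ((M₁ : ℤ) + i) *
      q ^ (tri (M₁ + i) - (M₁ + i) * (((M₁ + M₂ : ℕ) : ℤ) - 1 + i))) ≠ 0 :=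
    Finset.prod_ne_zero_iff.2 fun i _ =>
      mul_ne_zero (zpow_ne_zero _ (by simp)) (zpow_ne_zero _ hq0)
  have hone : (∏ i : Fin d, y ^ (0 : Fin d → ℤ) i *
      phase q r d M₁ (M₁ + M₂) i ((0 : Fin d → ℤ) i)) = 1 := by
    simp [phase, tri_zero]
  rw [hone, one_mul] at key
  refine mul_right_cancel₀ (mul_ne_zero hc hw) (Eq.trans ?_ key)
  ring

/-- The two ways of expanding the determinant `det (q ^ (i j) (q ^ (i n) - z q ^ j))`. -/
lemma sum_phase_eq_sum_phase_one (hq0 : q ≠ 0) (hq : ∀ m : ℕ, 0 < m → q ^ m ≠ 1) {n : ℕ}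
    (hn : 0 < n) {L N : ℕ} (hN : M₁ + M₂ = N) (hL : L + 1 = N + n) {z : F} (hz : z ≠ 0) :
    (∑ k ∈ Fintype.piFinset fun _ : Fin n => Icc (-(M₁ : ℤ)) M₂,
        (∏ i : Fin n, z ^ k i * phase q q n M₁ N i (k i)) * weight q n M₁ L k) *
      (∏ i ∈ range n, qPoch q q (N + i)) =
    (∑ k ∈ Fintype.piFinset fun _ : Fin 1 => Icc (-(M₂ : ℤ)) M₁,
        (∏ i : Fin 1, z⁻¹ ^ k i * phase q (q ^ n) 1 M₂ N i (k i)) * weight q 1 M₂ N k) *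
      qPoch q q N := by
  have hA := sum_phase_mul_weight hq0 hq hn hN hL hz hq0
  have hB := sum_phase_mul_weight hq0 hq one_pos (L := N) ((add_comm M₂ M₁).trans hN) rfl
    (inv_ne_zero hz) (pow_ne_zero n hq0)
  have hdet : (Matrix.of fun i j : Fin N => q ^ ((i : ℕ) * j) *
        (q ^ ((i : ℕ) * 1) - z⁻¹ * (q ^ n) ^ (j : ℕ))).det =
      (-z⁻¹) ^ N * (Matrix.of fun i j : Fin N =>
        q ^ ((i : ℕ) * j) * (q ^ ((i : ℕ) * n) - z * q ^ (j : ℕ))).det := by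
    have hsmul := Matrix.det_smul (Matrix.of fun i j : Fin N =>
        q ^ ((i : ℕ) * j) * (q ^ ((i : ℕ) * n) - z * q ^ (j : ℕ))).transpose (-z⁻¹)
    rw [Fintype.card_fin, Matrix.det_transpose] at hsmul
    rw [← hsmul]
    congr 1
    ext i j
    simp only [Matrix.of_apply, Matrix.smul_apply, Matrix.transpose_apply, smul_eq_mul]
    rw [← pow_mul, mul_one, mul_comm n, mul_comm (j : ℕ) (i : ℕ)]
    field_simp
    ring
  rw [hdet, ← hA, Finset.prod_range_add _ N n, Finset.prod_range_succ] at hB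
  have hK : (∏ b ∈ range N, ∏ a ∈ range b, -q ^ a) ≠ 0 :=
    Finset.prod_ne_zero_iff.2 fun b _ => Finset.prod_ne_zero_iff.2 fun a _ =>
      neg_ne_zero.2 (pow_ne_zero _ hq0)
  have hP : ∏ a ∈ range N, qPoch q q a ≠ 0 :=
    Finset.prod_ne_zero_iff.2 fun a _ => qPoch_ne_zero hq a
  have h1 : (q ^ n) ^ (∑ j ∈ range M₂, j) ≠ 0 := pow_ne_zero _ (pow_ne_zero _ hq0)
  have h2 : q ^ (∑ j ∈ range M₁, j) ≠ 0 := pow_ne_zero _ hq0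
  have h3 : (-z⁻¹) ^ M₂ ≠ 0 := pow_ne_zero _ (neg_ne_zero.2 (inv_ne_zero hz))
  have h4 : (-z⁻¹) ^ N * (-z) ^ M₁ = (-z⁻¹) ^ M₂ := by
    rw [← hN, pow_add, mul_right_comm, ← mul_pow, neg_mul_neg, inv_mul_cancel₀ hz, one_pow,
      one_mul]
  refine mul_right_cancel₀ (mul_ne_zero (mul_ne_zero (mul_ne_zero hK hP) (mul_ne_zero h1 h2)) h3)
    (Eq.trans ?_ (hB.symm.trans ?_))
  · rw [← h4, pow_mul q n]
    ring
  · rw [one_mul]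
    ring

/-- Laurent polynomials over a field containing an element of infinite order are determined by
their values. -/
lemma sum_ite_eq_of_sum_mul_zpow_eq (hq0 : q ≠ 0) (hq : ∀ m : ℕ, 0 < m → q ^ m ≠ 1)
    {α β : Type*} (A : Finset α) (f : α → ℤ) (a : α → F) (B : Finset β) (g : β → ℤ) (b : β → F)
    (h : ∀ z : F, z ≠ 0 → ∑ k ∈ A, a k * z ^ f k = ∑ k ∈ B, b k * z ^ g k) (S : ℤ) :
    ∑ k ∈ A, (if f k = S then a k else 0) = ∑ k ∈ B, if g k = S then b k else 0 := by
  let χ : ℤ → (Fˣ →* F) := fun s => (Units.coeHom F).comp (zpowGroupHom s)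
  have hχ : Function.Injective χ := fun s t hst => by
    have := DFunLike.congr_fun hst (Units.mk0 q hq0)
    exact zpow_injective hq0 hq (by simpa [χ] using this)
  have hli := (linearIndependent_monoidHom Fˣ F).comp χ hχ
  have hker := (linearIndependent_iff.1 hli)
    (∑ k ∈ A, Finsupp.single (f k) (a k) - ∑ k ∈ B, Finsupp.single (g k) (b k)) (by
      rw [map_sub, map_sum, map_sum, sub_eq_zero]
      funext z
      simpa [Finsupp.linearCombination_single, Finset.sum_apply, χ] using h z z.ne_zero)
  have := DFunLike.congr_fun hker S
  simpa [Finsupp.single_apply, sub_eq_zero] using this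

lemma prod_zpow_eq_zpow_sum {x : F} (hx : x ≠ 0) {ι : Type*} (s : Finset ι) (f : ι → ℤ) :
    ∏ i ∈ s, x ^ f i = x ^ ∑ i ∈ s, f i := by
  classical
  induction s using Finset.induction_on with
  | empty => simp
  | insert i s hi ih => rw [Finset.prod_insert hi, Finset.sum_insert hi, ih, zpow_add₀ hx]

lemma prod_phase (hq0 : q ≠ 0) {n : ℕ} (k : Fin n → ℤ) :
    ∏ i : Fin n, phase q q n M₁ (M₁ + M₂) i (k i) =
      (-1) ^ (n * ∑ i, k i) * q ^ ((((n + 1).choose 2 : ℕ) : ℤ) * (∑ i, (k i) ^ 2) +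
        ∑ i : Fin n, (((i : ℕ) : ℤ) + 1) * k i + (∑ i, k i) * (M₁ - n * M₂ - 1)) := by
  have hchoose : 2 * (((n + 1).choose 2 : ℕ) : ℤ) = (n + 1) * n := by
    have h := Nat.choose_two_right (n + 1)
    have h2 : 2 * (n + 1).choose 2 = (n + 1) * n := by
      rw [h, Nat.mul_div_cancel' (Nat.even_mul_pred_self (n + 1)).two_dvd, Nat.add_sub_cancel]
    exact_mod_cast h2
  have hterm : ∀ i : Fin n, phase q q n M₁ (M₁ + M₂) i (k i) =
      (-1) ^ (n * k i) * q ^ ((((n + 1).choose 2 : ℕ) : ℤ) * (k i) ^ 2 +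
        (((i : ℕ) : ℤ) + 1) * k i + k i * (M₁ - n * M₂ - 1)) := fun i => by
    rw [phase, mul_left_comm, ← zpow_add₀ hq0]
    congr 2
    have h1 := two_mul_tri (k i)
    have h2 := two_mul_tri (n * k i)
    push_cast
    linarith [congrArg (· * (k i) ^ 2) hchoose, congrArg (· * (n : ℤ)) h1]
  simp only [hterm, Finset.prod_mul_distrib, Finset.mul_sum, Finset.sum_mul,
    ← Finset.sum_add_distrib]
  rw [prod_zpow_eq_zpow_sum (by simp), prod_zpow_eq_zpow_sum hq0]

lemma phase_one (hq0 : q ≠ 0) (n : ℕ) (k : ℤ) :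
    phase q (q ^ n) 1 M₂ (M₁ + M₂) 0 k =
      (-1) ^ k * q ^ (((n : ℤ) + 1) * tri k - k * (M₁ - n * M₂ - 1)) := by
  rw [phase, ← zpow_natCast q n, ← zpow_mul, mul_left_comm, ← zpow_add₀ hq0]
  simp only [Nat.cast_one, one_mul]
  congr 2
  push_cast
  ring

lemma weight_eq_zero {L : ℕ} {k : Fin d → ℤ} (i : Fin d)
    (h : ¬ (0 ≤ (M₁ : ℤ) + i + d * k i ∧ (M₁ : ℤ) + i + d * k i ≤ L)) :
    weight q d M₁ L k = 0 := by
  rw [weight, Finset.prod_eq_zero (Finset.mem_univ i) (if_neg h), zero_mul]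

lemma weight_one {S : ℤ} (hS1 : -(M₁ : ℤ) ≤ S) (hS2 : S ≤ (M₂ : ℤ)) :
    weight q 1 M₂ (M₁ + M₂) (fun _ => -S) =
      1 / (qPoch q q ((M₁ : ℤ) + S).toNat * qPoch q q ((M₂ : ℤ) - S).toNat) := by
  have hfilter : univ.filter (fun i : Fin 1 => i < 0) = ∅ := by ext i; simp
  rw [weight, Fin.prod_univ_one, Fin.prod_univ_one, hfilter, Finset.prod_empty, mul_one,
    recipWeight]
  simp only [Fin.val_zero, Nat.cast_zero, Nat.cast_one, add_zero, one_mul, Nat.cast_add,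
    ← sub_eq_add_neg]
  rw [if_pos (by omega), mul_comm,
    show (M₁ : ℤ) + M₂ - (M₂ - S) = M₁ + S by ring]

lemma sum_box_eq (hq0 : q ≠ 0) (hq : ∀ m : ℕ, 0 < m → q ^ m ≠ 1) {n : ℕ} (hn : 0 < n) {L : ℕ}
    (hL : L + 1 = M₁ + M₂ + n) {S : ℤ} (hS1 : -(M₁ : ℤ) ≤ S) (hS2 : S ≤ (M₂ : ℤ)) :
    ∑ k ∈ Fintype.piFinset fun _ : Fin n => Icc (-(M₁ : ℤ)) M₂,
      (if ∑ i, k i = S then (∏ i : Fin n, phase q q n M₁ (M₁ + M₂) i (k i)) * weight q n M₁ L k *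
        ∏ i ∈ range n, qPoch q q (M₁ + M₂ + i) else 0) =
    (-1) ^ S * q ^ (((n : ℤ) + 1) * ((S + 1) * S / 2) + S * (M₁ - n * M₂ - 1)) *
      (1 / (qPoch q q ((M₁ : ℤ) + S).toNat * qPoch q q ((M₂ : ℤ) - S).toNat)) *
      qPoch q q (M₁ + M₂) := by
  rw [sum_ite_eq_of_sum_mul_zpow_eq hq0 hq _ (fun k : Fin n → ℤ => ∑ i, k i)
    (fun k => (∏ i : Fin n, phase q q n M₁ (M₁ + M₂) i (k i)) * weight q n M₁ L k *
        ∏ i ∈ range n, qPoch q q (M₁ + M₂ + i))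
    (Fintype.piFinset fun _ : Fin 1 => Icc (-(M₂ : ℤ)) M₁) (fun k => -k 0)
    (fun k => phase q (q ^ n) 1 M₂ (M₁ + M₂) 0 (k 0) * weight q 1 M₂ (M₁ + M₂) k *
      qPoch q q (M₁ + M₂)) ?_ S]
  · rw [Finset.sum_eq_single (fun _ => -S)]
    · rw [if_pos (neg_neg S), phase_one hq0, weight_one hS1 hS2, zpow_neg, ← inv_zpow,
        inv_neg_one, tri, show -S * (-S - 1) = (S + 1) * S by ring, neg_mul, sub_neg_eq_add]
    · intro k _ hk
      refine if_neg fun h => hk (funext fun i => ?_)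
      rw [Subsingleton.elim i 0]
      omega
    · intro h
      refine absurd (Fintype.mem_piFinset.2 fun _ => ?_) h
      rw [mem_Icc]
      omega
  · intro z hz
    have h := sum_phase_eq_sum_phase_one hq0 hq hn (M₁ := M₁) (M₂ := M₂) rfl hL hz
    rw [Finset.sum_mul, Finset.sum_mul] at h
    refine Eq.trans (Finset.sum_congr rfl fun k _ => ?_) (h.trans
      (Finset.sum_congr rfl fun k _ => ?_))
    · rw [Finset.prod_mul_distrib, prod_zpow_eq_zpow_sum hz]
      ring
    · rw [Fin.prod_univ_one, inv_zpow, zpow_neg, Fin.val_zero]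
      ring

end CyclicSum

/-- Warnaar's conjectured summation formula for an `Ã_{n-1}` basic hypergeometric series.
Note that `(S+1)*S/2` is the binomial coefficient `binom(S+1,2)` (the product is even,
so integer division is exact). -/
theorem warnaar_summation {F : Type*} [Field F] (q : F) (hq0 : q ≠ 0)
    (hq : ∀ m : ℕ, 0 < m → q ^ m ≠ 1)
    (n : ℕ) (hn : 0 < n) (M1 M2 : ℕ) (S : ℤ)
    (hS1 : -(M1 : ℤ) ≤ S) (hS2 : S ≤ (M2 : ℤ)) :
    (∑ᶠ k : Fin n → ℤ,
      if (∑ i, k i) = S ∧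
          ∀ i : Fin n, 0 ≤ (M1 : ℤ) + n * k i + (i : ℕ) ∧
            0 ≤ (M2 : ℤ) - n * k i + n - ((i : ℕ) + 1) then
        (-1 : F) ^ (((n : ℤ) - 1) * S) *
          q ^ ((((n + 1).choose 2 : ℕ) : ℤ) * (∑ i, (k i) ^ 2) +
              ∑ i : Fin n, (((i : ℕ) : ℤ) + 1) * k i) *
          (∏ j : Fin n, ∏ i ∈ Finset.univ.filter (fun i : Fin n => i < j),
            (1 - q ^ ((n : ℤ) * k j - (n : ℤ) * k i + ((j : ℕ) : ℤ) - ((i : ℕ) : ℤ)))) *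
          ∏ i : Fin n,
            qPoch q q (M1 + M2 + (i : ℕ)) /
              (qPoch q q ((M1 : ℤ) + n * k i + (i : ℕ)).toNat *
                qPoch q q ((M2 : ℤ) - n * k i + n - ((i : ℕ) + 1)).toNat)
      else 0) =
    q ^ (((n : ℤ) + 1) * ((S + 1) * S / 2)) *
      qPoch q q (M1 + M2) /
        (qPoch q q ((M1 : ℤ) + S).toNat * qPoch q q ((M2 : ℤ) - S).toNat) := by
  classical
  obtain ⟨L, hL⟩ : ∃ L, L + 1 = M1 + M2 + n := ⟨M1 + M2 + n - 1, by omega⟩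
  have key := CyclicSum.sum_box_eq hq0 hq hn hL hS1 hS2
  rw [finsum_eq_sum_of_support_subset (s := Fintype.piFinset fun _ : Fin n => Icc (-(M1 : ℤ)) M2)]
  · have hne : (-1 : F) ^ S * q ^ (S * ((M1 : ℤ) - n * M2 - 1)) ≠ 0 :=
      mul_ne_zero (zpow_ne_zero _ (by simp)) (zpow_ne_zero _ hq0)
    refine mul_left_cancel₀ hne (Eq.trans ?_ (key.trans ?_))
    · rw [Finset.mul_sum]
      refine Finset.sum_congr rfl fun k _ => ?_
      by_cases hS : ∑ i, k i = S
      · by_cases hk : ∀ i : Fin n, 0 ≤ (M1 : ℤ) + n * k i + (i : ℕ) ∧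
            0 ≤ (M2 : ℤ) - n * k i + n - ((i : ℕ) + 1)
        · rw [if_pos ⟨hS, hk⟩, if_pos hS, CyclicSum.prod_phase hq0, hS, CyclicSum.weight,
            zpow_add₀ hq0 _ (S * _), Finset.prod_div_distrib, Finset.prod_range,
            show (n : ℤ) * S = (n - 1) * S + S by ring, zpow_add₀ (by simp : (-1 : F) ≠ 0),
            div_eq_mul_inv, ← Finset.prod_inv_distrib]
          have hw : ∀ i : Fin n, CyclicSum.recipWeight q L ((M1 : ℤ) + i + n * k i) =
              (qPoch q q ((M1 : ℤ) + n * k i + (i : ℕ)).toNat *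
                qPoch q q ((M2 : ℤ) - n * k i + n - ((i : ℕ) + 1)).toNat)⁻¹ := fun i => by
            have h := hk i
            rw [CyclicSum.recipWeight, if_pos (by omega), one_div]
            congr 3 <;> congr 1 <;> omega
          simp only [hw]
          ring
        · rw [if_neg fun h => hk h.2, if_pos hS]
          obtain ⟨i, hi⟩ := not_forall.1 hk
          rw [CyclicSum.weight_eq_zero i (by omega)]
          ring
      · rw [if_neg fun h => hS h.1, if_neg hS, mul_zero]
    · rw [zpow_add₀ hq0]
      ring
  · intro k hk
    rw [Function.mem_support] at hk
    have hcond := (ite_ne_right_iff.1 hk).1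
    rw [Finset.mem_coe, Fintype.mem_piFinset]
    exact fun i => CyclicSum.mem_box i.isLt (hcond.2 i).1 (hcond.2 i).2
end

section
/- Let n be a positive integer and let M_1 and M_2 be nonnegative integers. Then the sum over all integer tuples (k_1,…,k_n) with k_1+⋯+k_n = 0 and with M_1 + n·k_i + i - 1 ≥ 0 and M_2 - n·k_i + n - i ≥ 0 for all i (a finite sum) of the quantity q^{binom(n+1,2)·(k_1²+⋯+k_n²) + (1·k_1+2·k_2+⋯+n·k_n)} · ∏_{1≤i<j≤n} (1 - q^{n·k_j - n·k_i + j - i}) · ∏_{i=1}^{n} (q;q)_{M_1+M_2+i-1} / ( (q;q)_{M_1+n·k_i+i-1} · (q;q)_{M_2-n·k_i+n-i} ) equals (q;q)_{M_1+M_2} / ( (q;q)_{M_1} · (q;q)_{M_2} ). -/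
open Finset

/-- The coefficient of `ζ ^ x` in the polynomial `E_N(ζ) = ∏_{t < N} (1 + q ^ t ζ)`. -/
def qCoeff {F : Type*} [Field F] (q : F) : ℕ → ℤ → F
  | 0, x => if x = 0 then 1 else 0
  | N + 1, x => qCoeff q N x + q ^ N * qCoeff q N (x - 1)

section qCoeff

variable {F : Type*} [Field F] {q : F}

lemma qPoch_self_succ (k : ℕ) : qPoch q q (k + 1) = qPoch q q k * (1 - q ^ (k + 1)) := by
  simp only [qPoch, prod_range_succ, pow_succ']

lemma qPoch_self_zero : qPoch q q 0 = 1 := by simp [qPoch]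

lemma qPoch_self_ne_zero (hq : ∀ m : ℕ, 0 < m → q ^ m ≠ 1) (k : ℕ) : qPoch q q k ≠ 0 := by
  refine prod_ne_zero_iff.2 fun j _ => ?_
  rw [← pow_succ', sub_ne_zero]
  exact (hq _ j.succ_pos).symm

lemma qCoeff_of_neg (N : ℕ) {x : ℤ} (hx : x < 0) : qCoeff q N x = 0 := by
  induction N generalizing x with
  | zero => simp [qCoeff, hx.ne]
  | succ N ih => simp [qCoeff, ih hx, ih (show x - 1 < 0 by omega)]

lemma qCoeff_of_gt (N : ℕ) {x : ℤ} (hx : (N : ℤ) < x) : qCoeff q N x = 0 := by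
  induction N generalizing x with
  | zero => simp [qCoeff, show x ≠ 0 by rintro rfl; simp at hx]
  | succ N ih =>
    push_cast at hx
    simp [qCoeff, ih (show (N : ℤ) < x by omega), ih (show (N : ℤ) < x - 1 by omega)]

lemma qCoeff_zero_right (N : ℕ) : qCoeff q N 0 = 1 := by
  induction N with
  | zero => simp [qCoeff]
  | succ N ih => simp [qCoeff, ih, qCoeff_of_neg]

lemma support_qCoeff_finite (N : ℕ) : (Function.support (qCoeff q N)).Finite := by
  refine (Set.finite_Icc (0 : ℤ) N).subset fun x hx => ⟨?_, ?_⟩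
  · by_contra! h
    exact hx (qCoeff_of_neg N h)
  · by_contra! h
    exact hx (qCoeff_of_gt N h)

/-- The `q`-Pascal rule coming from `E_{N+1}(ζ) = (1 + ζ) E_N(q ζ)`. -/
lemma qCoeff_succ (hq0 : q ≠ 0) (N : ℕ) (x : ℤ) :
    qCoeff q (N + 1) x = q ^ x * qCoeff q N x + q ^ (x - 1) * qCoeff q N (x - 1) := by
  induction N generalizing x with
  | zero =>
    simp only [qCoeff]
    by_cases h0 : x = 0
    · simp [h0]
    · by_cases h1 : x - 1 = 0
      · simp [h0, h1]
      · simp [h0, h1]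
  | succ N ih =>
    have i1 := ih x
    have i2 := ih (x - 1)
    have d0 : qCoeff q (N + 1 + 1) x =
      qCoeff q (N + 1) x + q ^ (N + 1) * qCoeff q (N + 1) (x - 1) := rfl
    have d1 : qCoeff q (N + 1) x = qCoeff q N x + q ^ N * qCoeff q N (x - 1) := rfl
    have d2 : qCoeff q (N + 1) (x - 1) =
      qCoeff q N (x - 1) + q ^ N * qCoeff q N (x - 1 - 1) := rfl
    simp only [zpow_sub_one₀ hq0] at i1 i2 ⊢
    linear_combination d0 + i1 + q ^ (N + 1) * i2 - q ^ x * d1 - q ^ x * q⁻¹ * d2 +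
      (qCoeff q N (x - 1) + q⁻¹ * qCoeff q N (x - 1 - 1)) * q ^ x * q ^ N * mul_inv_cancel₀ hq0

lemma qCoeff_absorb (hq0 : q ≠ 0) (N : ℕ) (x : ℤ) :
    (1 - q ^ (N + 1)) * qCoeff q N (x - 1) = q * (q ^ (-x) - 1) * qCoeff q (N + 1) x := by
  have h1 := qCoeff_succ hq0 N x
  have h2 : qCoeff q (N + 1) x = qCoeff q N x + q ^ N * qCoeff q N (x - 1) := rfl
  rw [zpow_sub_one₀ hq0] at h1
  rw [zpow_neg]
  have hx : q ^ x ≠ 0 := zpow_ne_zero _ hq0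
  have h3 : (q ^ x)⁻¹ * qCoeff q (N + 1) x = qCoeff q N x + q⁻¹ * qCoeff q N (x - 1) := by
    rw [h1]; field_simp
  calc _ = q * ((qCoeff q N x + q⁻¹ * qCoeff q N (x - 1)) -
        (qCoeff q N x + q ^ N * qCoeff q N (x - 1))) := by field_simp; ring
    _ = _ := by rw [← h3, ← h2]; ring

lemma qPoch_mul_qCoeff_sub (hq0 : q ≠ 0) (hq : ∀ m : ℕ, 0 < m → q ^ m ≠ 1) (N j : ℕ) (x : ℤ) :
    qPoch q q (N + j) * qCoeff q N (x - j) =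
      qPoch q q N * q ^ (j + 1).choose 2 *
        (∏ s ∈ range j, (q ^ (-x) - q ^ (-(s : ℤ)))) * qCoeff q (N + j) x := by
  induction j generalizing N with
  | zero => simp
  | succ j ih =>
    have h1 := qCoeff_absorb hq0 N (x - j)
    have h2 := ih (N + 1)
    rw [qPoch_self_succ, show N + 1 + j = N + (j + 1) by ring] at h2
    have h3 : q ^ (-(x - j)) - 1 = q ^ j * (q ^ (-x) - q ^ (-(j : ℤ))) := by
      rw [mul_sub, neg_sub, sub_eq_add_neg (j : ℤ), zpow_add₀ hq0, zpow_natCast, zpow_neg q j,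
        zpow_natCast, mul_inv_cancel₀ (pow_ne_zero _ hq0)]
    rw [h3] at h1
    rw [prod_range_succ, Nat.choose_succ_succ' (j + 1) 1, Nat.choose_one_right, pow_add,
      show (x - (j + 1 : ℕ) : ℤ) = x - j - 1 by push_cast; ring]
    have hN : 1 - q ^ (N + 1) ≠ 0 := sub_ne_zero.2 (hq _ N.succ_pos).symm
    apply mul_left_cancel₀ hN
    linear_combination qPoch q q (N + (j + 1)) * h1 +
      q ^ (j + 1) * (q ^ (-x) - q ^ (-(j : ℤ))) * h2

lemma qCoeff_mul_qPoch (a b : ℕ) :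
    qCoeff q (a + b) a * (qPoch q q a * qPoch q q b) =
      q ^ a.choose 2 * qPoch q q (a + b) := by
  induction h : a + b generalizing a b with
  | zero =>
    obtain ⟨rfl, rfl⟩ : a = 0 ∧ b = 0 := by omega
    simp [qCoeff, qPoch]
  | succ N ih =>
    rcases a with _ | a
    · obtain rfl : b = N + 1 := by omega
      simp [qCoeff_zero_right, qPoch_self_zero]
    · have hc : ((a + 1 : ℕ) : ℤ) - 1 = a := by push_cast; ring
      rw [qCoeff, hc, Nat.choose_succ_succ' a 1, Nat.choose_one_right, pow_add]
      rcases b with _ | b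
      · obtain rfl : a = N := by omega
        have := ih a 0 rfl
        rw [qCoeff_of_gt a (by push_cast; omega), qPoch_self_succ]
        simp only [qPoch_self_zero, mul_one] at this ⊢
        linear_combination q ^ a * (1 - q ^ (a + 1)) * this
      · obtain rfl : N = a + b + 1 := by omega
        have h1 := ih (a + 1) b (by omega)
        have h2 := ih a (b + 1) (by omega)
        rw [Nat.choose_succ_succ' a 1, Nat.choose_one_right, pow_add] at h1
        rw [qPoch_self_succ (a + b + 1)]
        rw [qPoch_self_succ] at h1 h2 ⊢
        rw [qPoch_self_succ b]
        linear_combination (1 - q ^ (b + 1)) * h1 + q ^ (a + b + 1) * (1 - q ^ (a + 1)) * h2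

/-- Comparing coefficients in `E_{N+p}(ζ) = E_N(ζ) E_p(q ^ N ζ)`. -/
lemma qCoeff_add (N p : ℕ) (x : ℤ) :
    qCoeff q (N + p) x =
      ∑ l ∈ range (p + 1), q ^ (N * l) * qCoeff q p l * qCoeff q N (x - l) := by
  induction p generalizing x with
  | zero => simp [qCoeff]
  | succ p ih =>
    rw [← add_assoc, qCoeff, ih, ih]
    simp only [qCoeff, mul_add, add_mul, sum_add_distrib]
    congr 1
    · rw [sum_range_succ _ (p + 1), qCoeff_of_gt p (x := (p + 1 : ℕ)) (by push_cast; omega)]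
      simp
    · rw [sum_range_succ' _ (p + 1), mul_sum]
      simp only [Nat.cast_zero, zero_sub, qCoeff_of_neg p (show (-1 : ℤ) < 0 by norm_num),
        mul_zero, zero_mul, add_zero]
      refine sum_congr rfl fun l _ => ?_
      push_cast
      rw [add_sub_cancel_right, show x - 1 - (l : ℤ) = x - (l + 1) by ring, pow_add]
      ring

end qCoeff

section Determinant

variable {F : Type*} [Field F] {q : F}

/-- The staircase determinant in the coefficients of `E_N` can be rewritten so that row `j`
involves `E_{N+m-j}`. -/
lemma det_qCoeff_eq_det_qCoeff_add (m N : ℕ) (x : Fin (m + 1) → ℤ) :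
    (Matrix.of fun j i : Fin (m + 1) => qCoeff q N (x i - (j : ℕ))).det =
      (Matrix.of fun j i : Fin (m + 1) => qCoeff q (N + (m - j)) (x i - (j : ℕ))).det := by
  let U : Matrix (Fin (m + 1)) (Fin (m + 1)) F := Matrix.of fun j l =>
    if j ≤ l then q ^ (N * (l - j : ℕ)) * qCoeff q (m - j) ((l - j : ℕ) : ℤ) else 0
  have hU : U.det = 1 := by
    rw [Matrix.det_of_isUpperTriangular]
    · simp [U, qCoeff_zero_right]
    · intro i j hij
      exact if_neg (not_le.2 hij)
  have key : (Matrix.of fun j i : Fin (m + 1) => qCoeff q (N + (m - j)) (x i - (j : ℕ))) =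
      U * Matrix.of fun j i : Fin (m + 1) => qCoeff q N (x i - (j : ℕ)) := by
    ext j i
    simp only [Matrix.mul_apply, U, Matrix.of_apply, ite_mul, zero_mul, Fin.le_def]
    rw [Fin.sum_univ_eq_sum_range (fun l => if (j : ℕ) ≤ l then
      q ^ (N * (l - j)) * qCoeff q (m - j) ((l - j : ℕ) : ℤ) * qCoeff q N (x i - (l : ℕ)) else 0),
      qCoeff_add, ← sum_filter]
    have hj : (j : ℕ) ≤ m := Nat.lt_succ_iff.1 j.2
    refine sum_bij (fun l _ => l + j) ?_ ?_ ?_ ?_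
    · intro l hl
      simp only [mem_range, mem_filter] at hl ⊢
      omega
    · intro a _ b _ h
      simpa using h
    · intro l hl
      simp only [mem_range, mem_filter] at hl
      exact ⟨l - j, by simp only [mem_range]; omega, by omega⟩
    · intro l _
      rw [Nat.add_sub_cancel]
      push_cast
      rw [show x i - ((l : ℤ) + (j : ℕ)) = x i - (j : ℕ) - l by ring]
  rw [key, Matrix.det_mul, hU, one_mul]

open Polynomial in
lemma det_prod_sub_eq_vandermonde {n : ℕ} (v : Fin n → F) (b : ℕ → F) :
    (Matrix.of fun j i : Fin n => ∏ s ∈ range j, (v i - b s)).det =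
      (Matrix.vandermonde v).det := by
  rw [Matrix.det_eval_matrixOfPolynomials_eq_det_vandermonde v
    (fun j => ∏ s ∈ range j, (X - C (b s))), ← Matrix.det_transpose]
  · congr 1
    ext i j
    simp [eval_prod]
  · intro i
    rw [natDegree_prod_of_monic _ _ fun s _ => monic_X_sub_C _]
    simp
  · exact fun i => monic_prod_of_monic _ _ fun s _ => monic_X_sub_C _

lemma det_vandermonde_zpow_neg (hq0 : q ≠ 0) {n : ℕ} (x : Fin n → ℤ) :
    (Matrix.vandermonde fun i => q ^ (-x i)).det =
      (∏ j : Fin n, q ^ (-((j : ℕ) * x j))) *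
        ∏ j : Fin n, ∏ i ∈ univ.filter (fun i : Fin n => i < j), (1 - q ^ (x j - x i)) := by
  rw [Matrix.det_vandermonde, prod_comm' (t' := univ)
    (s' := fun j : Fin n => univ.filter (fun i : Fin n => i < j)) (by simp), ← prod_mul_distrib]
  refine prod_congr rfl fun j _ => ?_
  have h : q ^ (-((j : ℕ) * x j)) = ∏ i ∈ univ.filter (fun i : Fin n => i < j), q ^ (-x j) := by
    rw [prod_const, show univ.filter (fun i : Fin n => i < j) = Iio j by ext; simp, Fin.card_Iio,
      ← zpow_natCast, ← zpow_mul]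
    congr 1
    ring
  rw [h, ← prod_mul_distrib]
  refine prod_congr rfl fun i _ => ?_
  rw [mul_sub, mul_one, ← zpow_add₀ hq0]
  congr 2
  ring

/-- Evaluation of the staircase determinant in the coefficients of `E_N`. -/
lemma det_qCoeff (hq0 : q ≠ 0) (hq : ∀ m : ℕ, 0 < m → q ^ m ≠ 1)
    (m N : ℕ) (x : Fin (m + 1) → ℤ) :
    (Matrix.of fun j i : Fin (m + 1) => qCoeff q N (x i - (j : ℕ))).det =
      (∏ j : Fin (m + 1), q ^ ((j : ℕ) + 1).choose 2) *
      (∏ i : Fin (m + 1), qPoch q q (N + i) * (qCoeff q (N + m) (x i) / qPoch q q (N + m))) *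
      ((∏ j : Fin (m + 1), q ^ (-((j : ℕ) * x j))) *
        ∏ j : Fin (m + 1), ∏ i ∈ univ.filter (fun i : Fin (m + 1) => i < j),
          (1 - q ^ (x j - x i))) := by
  have entry : ∀ j i : Fin (m + 1), qCoeff q (N + (m - j)) (x i - (j : ℕ)) =
      (qPoch q q (N + (m - j)) * q ^ ((j : ℕ) + 1).choose 2) *
        ((qCoeff q (N + m) (x i) / qPoch q q (N + m)) *
          ∏ s ∈ range j, (q ^ (-x i) - q ^ (-(s : ℤ)))) := by
    intro j i
    have hj : N + (m - j) + j = N + m := by have := j.2; omega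
    have h := qPoch_mul_qCoeff_sub hq0 hq (N + (m - j)) j (x i)
    rw [hj] at h
    have := qPoch_self_ne_zero hq (N + m)
    field_simp
    linear_combination h
  rw [det_qCoeff_eq_det_qCoeff_add]
  simp only [entry]
  refine (Matrix.det_mul_column (fun j : Fin (m + 1) =>
    qPoch q q (N + (m - j)) * q ^ ((j : ℕ) + 1).choose 2) _).trans ?_
  refine (congrArg _ (Matrix.det_mul_row (fun i => qCoeff q (N + m) (x i) / qPoch q q (N + m))
    (Matrix.of fun j i : Fin (m + 1) =>
      ∏ s ∈ range j, (q ^ (-x i) - q ^ (-(s : ℤ)))))).trans ?_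
  rw [det_prod_sub_eq_vandermonde, det_vandermonde_zpow_neg hq0, prod_mul_distrib,
    prod_mul_distrib]
  have hrev : ∏ j : Fin (m + 1), qPoch q q (N + (m - j)) =
      ∏ i : Fin (m + 1), qPoch q q (N + i) := by
    rw [← Equiv.prod_comp Fin.revPerm]
    refine prod_congr rfl fun i _ => ?_
    have := i.2
    simp only [Fin.revPerm_apply, Fin.val_rev]
    congr 1
    omega
  rw [hrev]
  ring

end Determinant

section CylindricSum

variable {F : Type*} [Field F] {q : F}

/-- The exponent of `q` attached to the translation `k`. -/
def cylExponent {n : ℕ} (k : Fin n → ℤ) : ℤ :=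
  ∑ i, (n * (k i * (k i - 1) / 2) + (i : ℕ) * k i)

/-- The weight of the translation `k`; only translations in the root lattice contribute. -/
def cylWeight {n : ℕ} (q : F) (k : Fin n → ℤ) : F :=
  if ∑ i, k i = 0 then q ^ cylExponent k else 0

/-- The position of particle `i` after translation by `k`. -/
def cylPos {n : ℕ} (M : ℤ) (k : Fin n → ℤ) (i : Fin n) : ℤ := M + n * k i + (i : ℕ)

/-- The alternating sum over the affine symmetric group of products of the `f j`. -/
noncomputable def cylSum {n : ℕ} (q : F) (M : ℤ) (f : Fin n → ℤ → F) : F :=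
  ∑ᶠ k : Fin n → ℤ, cylWeight q k * (Matrix.of fun j i => f j (cylPos M k i)).det

lemma finite_setOf_cylPos_mem {n : ℕ} (M : ℤ) {s : Set ℤ} (hs : s.Finite) :
    {k : Fin n → ℤ | ∀ i, cylPos M k i ∈ s}.Finite := by
  have : {k : Fin n → ℤ | ∀ i, cylPos M k i ∈ s} =
      Set.pi Set.univ fun i : Fin n => {z : ℤ | M + n * z + (i : ℕ) ∈ s} := by
    ext k
    simp [cylPos]
  rw [this]
  refine Set.Finite.pi fun i => hs.preimage ?_
  intro a _ b _ h
  have hn : (n : ℤ) ≠ 0 := by have := i.2; omega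
  have h' : (n : ℤ) * a = n * b := by simpa using h
  exact mul_left_cancel₀ hn h'

lemma support_cylWeight_mul_prod_finite {n : ℕ} (M : ℤ) (f : Fin n → ℤ → F)
    (hf : ∀ j, (Function.support (f j)).Finite) (σ : Equiv.Perm (Fin n)) (c : F) :
    (Function.support fun k : Fin n → ℤ =>
      c * (cylWeight q k * ∏ i, f (σ i) (cylPos M k i))).Finite := by
  refine (finite_setOf_cylPos_mem M (Set.finite_iUnion hf)).subset fun k hk i => ?_
  simp only [Function.mem_support, ne_eq, mul_eq_zero, not_or, prod_eq_zero_iff, not_exists] at hk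
  exact Set.mem_iUnion.2 ⟨σ i, fun h => hk.2.2 i ⟨mem_univ _, h⟩⟩

lemma support_cylSum_finite {n : ℕ} (M : ℤ) (f : Fin n → ℤ → F)
    (hf : ∀ j, (Function.support (f j)).Finite) :
    (Function.support fun k : Fin n → ℤ =>
      cylWeight q k * (Matrix.of fun j i => f j (cylPos M k i)).det).Finite := by
  refine (finite_setOf_cylPos_mem M (Set.finite_iUnion hf)).subset fun k hk i => ?_
  by_contra h
  refine hk ?_
  dsimp only
  rw [Matrix.det_eq_zero_of_column_eq_zero i, mul_zero]
  intro j
  by_contra h'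
  exact h (Set.mem_iUnion.2 ⟨j, h'⟩)

lemma cylSum_eq_sum_perm {n : ℕ} (M : ℤ) (f : Fin n → ℤ → F)
    (hf : ∀ j, (Function.support (f j)).Finite) :
    cylSum q M f = ∑ σ : Equiv.Perm (Fin n), (Equiv.Perm.sign σ : F) *
      ∑ᶠ k : Fin n → ℤ, cylWeight q k * ∏ i, f (σ i) (cylPos M k i) := by
  have h : ∀ k : Fin n → ℤ, cylWeight q k * (Matrix.of fun j i => f j (cylPos M k i)).det =
      ∑ σ : Equiv.Perm (Fin n), (Equiv.Perm.sign σ : F) *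
        (cylWeight q k * ∏ i, f (σ i) (cylPos M k i)) := by
    intro k
    rw [Matrix.det_apply', mul_sum]
    refine sum_congr rfl fun σ _ => ?_
    simp only [Matrix.of_apply]
    ring
  rw [cylSum]
  simp only [h]
  rw [finsum_sum_comm _ _ fun σ _ => support_cylWeight_mul_prod_finite M f hf σ _]
  refine sum_congr rfl fun σ _ => ?_
  rw [mul_finsum]

lemma finRotate_val_int (m : ℕ) (i : Fin (m + 1)) :
    ((finRotate (m + 1) i : ℕ) : ℤ) =
      (i : ℕ) + 1 - (m + 1) * (if finRotate (m + 1) i = 0 then 1 else 0) := by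
  by_cases h : i = Fin.last m
  · subst h
    simp
  · have h1 := coe_finRotate_of_ne_last h
    rw [if_neg (fun h0 => by rw [h0] at h1; simp at h1), h1]
    push_cast
    ring

/-- The translation vector obtained from `k` by rotating the cylinder by one step and moving
particle `σ⁻¹ 0` once around it. -/
def cylRotate {m : ℕ} (σ : Equiv.Perm (Fin (m + 1))) :
    (Fin (m + 1) → ℤ) ≃ (Fin (m + 1) → ℤ) :=
  (Equiv.arrowCongr (finRotate (m + 1)).symm (Equiv.refl ℤ)).trans
    (Equiv.addRight fun i => (if σ (finRotate (m + 1) i) = 0 then 1 else 0) -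
      (if finRotate (m + 1) i = 0 then 1 else 0))

lemma cylRotate_apply {m : ℕ} (σ : Equiv.Perm (Fin (m + 1))) (k : Fin (m + 1) → ℤ)
    (i : Fin (m + 1)) :
    cylRotate σ k i = k (finRotate (m + 1) i) +
      ((if σ (finRotate (m + 1) i) = 0 then 1 else 0) -
        (if finRotate (m + 1) i = 0 then 1 else 0)) := rfl

lemma sum_ite_perm_eq_zero {m : ℕ} (σ : Equiv.Perm (Fin (m + 1))) (g : Fin (m + 1) → ℤ) :
    ∑ i, (if σ i = 0 then g i else 0) = g (σ.symm 0) := by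
  simp [← Equiv.eq_symm_apply]

lemma sum_cylRotate {m : ℕ} (σ : Equiv.Perm (Fin (m + 1))) (k : Fin (m + 1) → ℤ) :
    ∑ i, cylRotate σ k i = ∑ i, k i := by
  simp only [cylRotate_apply]
  rw [Equiv.sum_comp (finRotate (m + 1)) fun i =>
    k i + ((if σ i = 0 then (1 : ℤ) else 0) - if i = 0 then 1 else 0),
    sum_add_distrib, sum_sub_distrib, sum_ite_perm_eq_zero σ fun _ => 1]
  simp

lemma two_mul_choose_two_int (a : ℤ) : 2 * (a * (a - 1) / 2) = a * (a - 1) :=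
  Int.mul_ediv_cancel' (by
    have := Int.even_mul_succ_self (a - 1)
    rw [sub_add_cancel, mul_comm] at this
    exact this.two_dvd)

lemma cylExponent_cylRotate {m : ℕ} (σ : Equiv.Perm (Fin (m + 1))) (k : Fin (m + 1) → ℤ)
    (hk : ∑ i, k i = 0) :
    cylExponent (cylRotate σ k) = cylExponent k + cylPos 0 k (σ.symm 0) := by
  have h : ∀ i, ((m + 1 : ℕ) : ℤ) * (cylRotate σ k i * (cylRotate σ k i - 1) / 2) +
      (i : ℕ) * cylRotate σ k i =
      (fun i : Fin (m + 1) => (((m + 1 : ℕ) : ℤ) * (k i * (k i - 1) / 2) + (i : ℕ) * k i) - k i +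
        (if i = 0 then 1 else 0) +
        (if σ i = 0 then cylPos 0 k i - 1 else 0)) (finRotate (m + 1) i) := by
    intro i
    have e := finRotate_val_int m i
    have h1 := two_mul_choose_two_int (cylRotate σ k i)
    have h2 := two_mul_choose_two_int (k (finRotate (m + 1) i))
    have hr := cylRotate_apply σ k i
    simp only [cylPos]
    generalize cylRotate σ k i = z at *
    generalize finRotate (m + 1) i = i' at *
    apply mul_left_cancel₀ (two_ne_zero (α := ℤ))
    have e' : ((i : ℕ) : ℤ) = (i' : ℕ) - 1 + (m + 1) * (if i' = 0 then 1 else 0) := by linarith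
    rw [e', mul_add 2, mul_left_comm 2, h1, mul_add 2, mul_add 2, mul_sub 2, mul_add 2,
      mul_left_comm 2 ((m + 1 : ℕ) : ℤ), h2, hr]
    by_cases hi : i' = 0
    · by_cases hs : σ i' = 0
      · simp [hi, hi ▸ hs]; ring
      · simp [hi, hi ▸ hs]; ring
    · by_cases hs : σ i' = 0
      · simp [hi, hs]; ring
      · simp [hi, hs]; ring
  refine (Fintype.sum_equiv (finRotate (m + 1)) _
    (fun i => (((m + 1 : ℕ) : ℤ) * (k i * (k i - 1) / 2) + (i : ℕ) * k i) - k i +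
      (if i = 0 then 1 else 0) + (if σ i = 0 then cylPos 0 k i - 1 else 0)) h).trans ?_
  rw [sum_add_distrib, sum_add_distrib, sum_sub_distrib, hk,
    sum_ite_perm_eq_zero σ fun i => cylPos 0 k i - 1, cylExponent]
  simp

lemma cylWeight_cylRotate (hq0 : q ≠ 0) {m : ℕ} (σ : Equiv.Perm (Fin (m + 1)))
    (k : Fin (m + 1) → ℤ) (M : ℤ) :
    q ^ M * cylWeight q (cylRotate σ k) = q ^ cylPos M k (σ.symm 0) * cylWeight q k := by
  rw [cylWeight, cylWeight, sum_cylRotate]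
  split_ifs with hk
  · rw [cylExponent_cylRotate σ k hk, ← zpow_add₀ hq0, ← zpow_add₀ hq0]
    congr 1
    simp only [cylPos]
    ring
  · simp

/-- The functional `cylSum` is invariant under rotation of the cylinder: multiplying the
particle in row `0` by `q ^ x` only changes the sum by the factor `q ^ M`. -/
lemma cylSum_rotate (hq0 : q ≠ 0) {m : ℕ} (M : ℤ) (c : ℤ → F)
    (hc : (Function.support c).Finite) :
    cylSum q M (fun (j : Fin (m + 1)) x => (if j = 0 then q ^ x else 1) * c (x - (j : ℕ))) =
      q ^ M * cylSum q M (fun (j : Fin (m + 1)) x => c (x - (j : ℕ))) := by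
  have hc' : ∀ j : Fin (m + 1), (Function.support fun x : ℤ => c (x - (j : ℕ))).Finite :=
    fun j => hc.preimage (sub_left_injective.injOn)
  rw [cylSum_eq_sum_perm _ _ hc', cylSum_eq_sum_perm _ _ fun j => (hc' j).subset fun x hx =>
    right_ne_zero_of_mul hx, mul_sum]
  let ρ := finRotate (m + 1)
  refine Fintype.sum_equiv (MulAut.conj ρ⁻¹).toEquiv _ _ fun σ => ?_
  have hsign : Equiv.Perm.sign ((MulAut.conj ρ⁻¹).toEquiv σ) = Equiv.Perm.sign σ := by
    simp only [MulEquiv.toEquiv_eq_coe, EquivLike.coe_coe, MulAut.conj_apply, map_mul, inv_inv,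
      Equiv.Perm.sign_inv]
    rw [mul_right_comm, Int.units_mul_self, one_mul]
  rw [hsign, mul_left_comm]
  congr 1
  refine Eq.trans ?_ (congrArg _ (finsum_comp_equiv (cylRotate σ)))
  rw [mul_finsum]
  refine finsum_congr fun k => ?_
  rw [← mul_assoc, cylWeight_cylRotate hq0, prod_mul_distrib]
  have h1 : ∏ i, (if σ i = 0 then q ^ cylPos M k i else 1) = q ^ cylPos M k (σ.symm 0) := by
    simp [← Equiv.eq_symm_apply]
  rw [h1, mul_left_comm, mul_assoc, ← Equiv.prod_comp ρ]
  congr 2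
  refine prod_congr rfl fun i _ => ?_
  refine congrArg c ?_
  have e1 := finRotate_val_int m i
  have e2 := finRotate_val_int m (ρ.symm (σ (ρ i)))
  have e3 : (MulAut.conj ρ⁻¹).toEquiv σ i = ρ.symm (σ (ρ i)) := rfl
  have e4 : finRotate (m + 1) (ρ.symm (σ (ρ i))) = σ (ρ i) := ρ.apply_symm_apply _
  have e5 : finRotate (m + 1) i = ρ i := rfl
  rw [e4] at e2
  rw [e3]
  simp only [cylPos, cylRotate_apply]
  rw [e5] at e1 ⊢
  push_cast
  linear_combination e1 - e2

end CylindricSum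

section Evaluation

variable {F : Type*} [Field F] {q : F}

lemma prod_zpow_eq_zpow_sum (hq0 : q ≠ 0) {ι : Type*} (s : Finset ι) (e : ι → ℤ) :
    ∏ i ∈ s, q ^ e i = q ^ ∑ i ∈ s, e i := by
  classical
  induction s using Finset.induction_on with
  | empty => simp
  | insert a s ha ih => rw [prod_insert ha, sum_insert ha, ih, zpow_add₀ hq0]

lemma det_zpow_mul_qCoeff (hq0 : q ≠ 0) {n : ℕ} (N : ℕ) (x : Fin n → ℤ) :
    (Matrix.of fun j i : Fin n => q ^ (x i - (j : ℕ)) * qCoeff q N (x i - (j : ℕ))).det =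
      q ^ (∑ i, (x i - (i : ℕ))) *
        (Matrix.of fun j i : Fin n => qCoeff q N (x i - (j : ℕ))).det := by
  have h : ∀ j i : Fin n, q ^ (x i - (j : ℕ)) * qCoeff q N (x i - (j : ℕ)) =
      q ^ (-((j : ℕ) : ℤ)) * (q ^ x i * qCoeff q N (x i - (j : ℕ))) := by
    intro j i
    rw [sub_eq_neg_add, zpow_add₀ hq0, mul_assoc]
  simp only [h]
  refine (Matrix.det_mul_column (fun j : Fin n => q ^ (-((j : ℕ) : ℤ))) _).trans ?_
  refine (congrArg _ (Matrix.det_mul_row (fun i => q ^ x i)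
    (Matrix.of fun j i : Fin n => qCoeff q N (x i - (j : ℕ))))).trans ?_
  rw [← mul_assoc, ← prod_mul_distrib, ← prod_zpow_eq_zpow_sum hq0]
  congr 1
  refine prod_congr rfl fun i _ => ?_
  rw [← zpow_add₀ hq0, neg_add_eq_sub]

/-- Replacing the row `E_{N+1}(ζ)` by `E_{N+1}(q ζ)` in the staircase determinant. -/
lemma det_ite_zpow_mul_qCoeff (hq0 : q ≠ 0) (m N : ℕ) (x : Fin (m + 1) → ℤ) :
    (Matrix.of fun j i : Fin (m + 1) =>
        (if j = 0 then q ^ x i else 1) * qCoeff q (N + 1) (x i - (j : ℕ))).det =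
      (Matrix.of fun j i : Fin (m + 1) => qCoeff q (N + 1) (x i - (j : ℕ))).det -
      (1 - q ^ (N + 1)) * (Matrix.of fun j i : Fin (m + 1) =>
        q ^ (x i - 1 - (j : ℕ)) * qCoeff q N (x i - 1 - (j : ℕ))).det := by
  let d : ℤ → F := fun y => q ^ y * qCoeff q N y
  let A := Matrix.of fun j i : Fin (m + 1) => qCoeff q (N + 1) (x i - (j : ℕ))
  have hd : ∀ y, qCoeff q (N + 1) y = d y + d (y - 1) := qCoeff_succ hq0 N
  have hd' : ∀ y, q ^ y * qCoeff q (N + 1) y =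
      qCoeff q (N + 1) y + (-(1 - q ^ (N + 1))) * d (y - 1) := by
    intro y
    have h : q ^ y * qCoeff q (N + 1) y = d y + q ^ (N + 1) * d (y - 1) := by
      simp only [qCoeff, d, zpow_sub_one₀ hq0, pow_succ]
      field_simp
    rw [h, hd]
    ring
  have h1 : (Matrix.of fun j i : Fin (m + 1) =>
      (if j = 0 then q ^ x i else 1) * qCoeff q (N + 1) (x i - (j : ℕ))) =
      A.updateRow 0 (A 0 + (-(1 - q ^ (N + 1))) • fun i => d (x i - 1)) := by
    ext j i
    rcases eq_or_ne j 0 with rfl | hj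
    · simp [A, hd']
    · simp [A, hj]
  have h2 : (A.updateRow 0 fun i => d (x i - 1)).det =
      (Matrix.of fun j i : Fin (m + 1) => d (x i - 1 - (j : ℕ))).det := by
    symm
    refine Matrix.det_eq_of_forall_row_eq_smul_add_pred (fun _ => -1) ?_ ?_
    · intro i
      simp
    · intro j i
      rw [Matrix.updateRow_ne (Fin.succ_ne_zero j)]
      simp only [Matrix.of_apply, A, hd, Fin.val_succ, Fin.val_castSucc]
      push_cast
      rw [show x i - 1 - ((j : ℕ) : ℤ) = x i - ((j : ℕ) + 1) by ring,
        show x i - 1 - (((j : ℕ) : ℤ) + 1) = x i - ((j : ℕ) + 1) - 1 by ring]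
      ring
  rw [h1, Matrix.det_updateRow_add, Matrix.det_updateRow_smul, Matrix.updateRow_eq_self, h2]
  simp only [A, d]
  ring

lemma support_qCoeff_sub_finite (N j : ℕ) :
    (Function.support fun x : ℤ => qCoeff q N (x - j)).Finite :=
  (support_qCoeff_finite N).preimage sub_left_injective.injOn

lemma sum_cylPos_sub {n : ℕ} (M : ℤ) (k : Fin n → ℤ) (hk : ∑ i, k i = 0) :
    ∑ i, (cylPos M k i - (i : ℕ)) = n * M := by
  simp only [cylPos, add_sub_cancel_right]
  rw [sum_add_distrib, ← mul_sum, hk]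
  simp

lemma cylSum_qCoeff_succ (hq0 : q ≠ 0) (m N : ℕ) (M : ℤ) :
    (1 - q ^ M) * cylSum q M (fun (j : Fin (m + 1)) x => qCoeff q (N + 1) (x - (j : ℕ))) =
      (1 - q ^ (N + 1)) * q ^ ((m + 1 : ℕ) * (M - 1)) *
        cylSum q (M - 1) (fun (j : Fin (m + 1)) x => qCoeff q N (x - (j : ℕ))) := by
  have hrot := cylSum_rotate hq0 (m := m) M (qCoeff q (N + 1)) (support_qCoeff_finite _)
  have hpt : ∀ k : Fin (m + 1) → ℤ,
      cylWeight q k * (Matrix.of fun j i : Fin (m + 1) =>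
        (if j = 0 then q ^ cylPos M k i else 1) *
          qCoeff q (N + 1) (cylPos M k i - (j : ℕ))).det =
      cylWeight q k * (Matrix.of fun j i : Fin (m + 1) =>
        qCoeff q (N + 1) (cylPos M k i - (j : ℕ))).det -
      (1 - q ^ (N + 1)) * q ^ ((m + 1 : ℕ) * (M - 1)) *
        (cylWeight q k * (Matrix.of fun j i : Fin (m + 1) =>
          qCoeff q N (cylPos (M - 1) k i - (j : ℕ))).det) := by
    intro k
    by_cases hk : ∑ i, k i = 0
    · have hpos : ∀ i, cylPos M k i - 1 = cylPos (M - 1) k i := fun i => by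
        simp only [cylPos]; ring
      rw [det_ite_zpow_mul_qCoeff hq0]
      simp only [hpos]
      rw [det_zpow_mul_qCoeff hq0, sum_cylPos_sub _ _ hk]
      ring
    · simp [cylWeight, hk]
  rw [one_sub_mul, ← hrot]
  simp only [cylSum, hpt]
  rw [finsum_sub_distrib, ← mul_finsum, sub_sub_cancel]
  · exact support_cylSum_finite M _ fun j => support_qCoeff_sub_finite _ _
  · refine (support_cylSum_finite (q := q) (M - 1) _ fun j : Fin (m + 1) =>
      support_qCoeff_sub_finite (q := q) N j).subset fun k hk => right_ne_zero_of_mul hk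

lemma cylSum_qCoeff_zero (m N : ℕ) :
    cylSum q 0 (fun (j : Fin (m + 1)) x => qCoeff q N (x - (j : ℕ))) = 1 := by
  rw [cylSum, finsum_eq_single _ 0]
  · have hdet : (Matrix.of fun j i : Fin (m + 1) =>
        qCoeff q N (cylPos 0 (0 : Fin (m + 1) → ℤ) i - (j : ℕ))).det = 1 := by
      rw [Matrix.det_of_isUpperTriangular]
      · simp [cylPos, qCoeff_zero_right]
      · intro j i hij
        have hij' : (i : ℕ) < j := hij
        refine qCoeff_of_neg N ?_
        simp only [cylPos, Pi.zero_apply]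
        omega
    rw [hdet]
    simp [cylWeight, cylExponent]
  · intro k hk
    by_contra h
    refine hk ?_
    have hw : ∑ i, k i = 0 := by
      by_contra h0
      simp [cylWeight, h0] at h
    have hdet := right_ne_zero_of_mul h
    rw [Matrix.det_apply'] at hdet
    obtain ⟨σ, -, hσ⟩ := exists_ne_zero_of_sum_ne_zero hdet
    have hnn : ∀ i, 0 ≤ k i := by
      intro i
      by_contra! hi
      refine prod_ne_zero_iff.1 (right_ne_zero_of_mul hσ) i (mem_univ _) (qCoeff_of_neg N ?_)
      have h1 : ((m + 1 : ℕ) : ℤ) * k i ≤ ((m + 1 : ℕ) : ℤ) * (-1) :=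
        mul_le_mul_of_nonneg_left (by omega) (by omega)
      have := i.2
      simp only [cylPos]
      omega
    funext i
    exact (sum_eq_zero_iff_of_nonneg fun i _ => hnn i).1 hw i (mem_univ _)

lemma cylSum_qCoeff (hq0 : q ≠ 0) (hq : ∀ m : ℕ, 0 < m → q ^ m ≠ 1) (m a b : ℕ) :
    cylSum q a (fun (j : Fin (m + 1)) x => qCoeff q (a + b) (x - (j : ℕ))) =
      q ^ ((m + 1) * a.choose 2) * (qPoch q q (a + b) / (qPoch q q a * qPoch q q b)) := by
  induction a with
  | zero =>
    have := qPoch_self_ne_zero hq b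
    rw [Nat.cast_zero, cylSum_qCoeff_zero]
    simp [qPoch_self_zero, this]
  | succ a ih =>
    have h := cylSum_qCoeff_succ hq0 m (a + b) ((a + 1 : ℕ) : ℤ)
    rw [show ((a + 1 : ℕ) : ℤ) - 1 = a by push_cast; ring, ih, ← Nat.cast_mul, zpow_natCast,
      zpow_natCast] at h
    have h0 : 1 - q ^ (a + 1) ≠ 0 := sub_ne_zero.2 (hq _ a.succ_pos).symm
    apply mul_left_cancel₀ h0
    rw [show a + 1 + b = a + b + 1 by ring, h, qPoch_self_succ, qPoch_self_succ,
      Nat.choose_succ_succ' a 1, Nat.choose_one_right, one_add_one_eq_two, mul_add (m + 1), pow_add,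
      pow_add]
    have := qPoch_self_ne_zero hq a
    have := qPoch_self_ne_zero hq b
    field_simp
    ring

lemma two_mul_natCast_choose_two (a : ℕ) : (2 : ℤ) * (a.choose 2 : ℕ) = a * (a - 1) := by
  have h := two_mul_choose_two_int a
  rw [← h, Nat.choose_two_right]
  rcases a with _ | a
  · simp
  · push_cast
    simp

lemma exponent_identity (m M : ℕ) (k : Fin (m + 1) → ℤ) (hk : ∑ i, k i = 0)
    (a : Fin (m + 1) → ℕ) (ha : ∀ i, (a i : ℤ) = cylPos M k i) :
    cylExponent k + ∑ i : Fin (m + 1), ((((i : ℕ) + 1).choose 2 : ℕ) : ℤ) +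
      ∑ i, (((a i).choose 2 : ℕ) : ℤ) + ∑ i : Fin (m + 1), -((i : ℕ) * cylPos M k i) =
    (((m + 1) * M.choose 2 : ℕ) : ℤ) +
      ((((m + 1 + 1).choose 2 : ℕ) : ℤ) * (∑ i, (k i) ^ 2) +
        ∑ i : Fin (m + 1), (((i : ℕ) : ℤ) + 1) * k i) := by
  have hconst : (((m + 1) * M.choose 2 : ℕ) : ℤ) =
      ∑ i : Fin (m + 1), ((M.choose 2 : ℕ) : ℤ) := by simp
  have hlin : ∑ i, (m + 2 - (m + 1 : ℤ) * M) * k i = 0 := by rw [← mul_sum, hk, mul_zero]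
  rw [cylExponent, hconst, mul_sum, ← sum_add_distrib, ← sum_add_distrib, ← sum_add_distrib,
    ← sum_add_distrib, ← sum_add_distrib, ← add_zero (∑ i, (_ + _)), ← hlin,
    ← sum_add_distrib]
  refine sum_congr rfl fun i _ => ?_
  have h1 := two_mul_choose_two_int (k i)
  have h2 := two_mul_natCast_choose_two ((i : ℕ) + 1)
  have h3 := two_mul_natCast_choose_two (a i)
  have h4 := two_mul_natCast_choose_two M
  have h5 := two_mul_natCast_choose_two (m + 1 + 1)
  rw [ha, cylPos] at h3
  rw [cylPos]
  push_cast at *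
  apply mul_left_cancel₀ (two_ne_zero (α := ℤ))
  linear_combination (m + 1 : ℤ) * h1 + h2 + h3 - h4 - k i ^ 2 * h5

end Evaluation

section Summand

variable {F : Type*} [Field F] {q : F}

lemma cylWeight_mul_det_qCoeff (hq0 : q ≠ 0) (hq : ∀ m : ℕ, 0 < m → q ^ m ≠ 1)
    (m M N : ℕ) (k : Fin (m + 1) → ℤ) (hk : ∑ i, k i = 0) (a b : Fin (m + 1) → ℕ)
    (ha : ∀ i, (a i : ℤ) = cylPos M k i) (hab : ∀ i, a i + b i = N + m) :
    cylWeight q k *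
      (Matrix.of fun j i : Fin (m + 1) => qCoeff q N (cylPos M k i - (j : ℕ))).det =
    q ^ ((m + 1) * M.choose 2) *
      (q ^ ((((m + 1 + 1).choose 2 : ℕ) : ℤ) * (∑ i, (k i) ^ 2) +
          ∑ i : Fin (m + 1), (((i : ℕ) : ℤ) + 1) * k i) *
        (∏ j : Fin (m + 1), ∏ i ∈ univ.filter (fun i : Fin (m + 1) => i < j),
          (1 - q ^ (cylPos M k j - cylPos M k i))) *
        ∏ i : Fin (m + 1), qPoch q q (N + i) / (qPoch q q (a i) * qPoch q q (b i))) := by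
  have hc : ∀ i : Fin (m + 1),
      qPoch q q (N + i) * (qCoeff q (N + m) (cylPos M k i) / qPoch q q (N + m)) =
      q ^ (((a i).choose 2 : ℕ) : ℤ) *
        (qPoch q q (N + i) / (qPoch q q (a i) * qPoch q q (b i))) := by
    intro i
    have h := qCoeff_mul_qPoch (q := q) (a i) (b i)
    have h1 := qPoch_self_ne_zero hq (a i)
    have h2 := qPoch_self_ne_zero hq (b i)
    have h3 := qPoch_self_ne_zero hq (N + m)
    rw [hab, ha] at h
    rw [zpow_natCast]
    field_simp
    linear_combination qPoch q q (N + i) * h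
  have hE := congrArg (q ^ ·) (exponent_identity m M k hk a ha)
  simp only [zpow_add₀ hq0, ← prod_zpow_eq_zpow_sum hq0] at hE
  rw [det_qCoeff hq0 hq, prod_congr rfl fun i _ => hc i, prod_mul_distrib, cylWeight, if_pos hk]
  simp only [zpow_add₀ hq0, ← prod_zpow_eq_zpow_sum hq0]
  simp only [zpow_natCast] at hE ⊢
  linear_combination
    (∏ j : Fin (m + 1), ∏ i ∈ univ.filter (fun i : Fin (m + 1) => i < j),
      (1 - q ^ (cylPos M k j - cylPos M k i))) *
    (∏ i : Fin (m + 1), qPoch q q (N + i) / (qPoch q q (a i) * qPoch q q (b i))) * hE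

lemma det_qCoeff_eq_zero (hq0 : q ≠ 0) (hq : ∀ m : ℕ, 0 < m → q ^ m ≠ 1)
    (m N : ℕ) (x : Fin (m + 1) → ℤ) (i : Fin (m + 1)) (hx : x i < 0 ∨ (N + m : ℤ) < x i) :
    (Matrix.of fun j i : Fin (m + 1) => qCoeff q N (x i - (j : ℕ))).det = 0 := by
  have h0 : qCoeff q (N + m) (x i) = 0 := by
    rcases hx with hx | hx
    · exact qCoeff_of_neg _ hx
    · exact qCoeff_of_gt _ (by push_cast; exact hx)
  have hz : ∏ i : Fin (m + 1),
      qPoch q q (N + i) * (qCoeff q (N + m) (x i) / qPoch q q (N + m)) = 0 :=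
    prod_eq_zero (mem_univ i) (by rw [h0]; simp)
  rw [det_qCoeff hq0 hq, hz]
  simp

end Summand

/-- The case `S = 0` of Warnaar's conjectured summation formula. -/
theorem warnaar_sum_S_zero {F : Type*} [Field F] (q : F) (hq0 : q ≠ 0)
    (hq : ∀ m : ℕ, 0 < m → q ^ m ≠ 1)
    (n : ℕ) (hn : 0 < n) (M1 M2 : ℕ) :
    (∑ᶠ k : Fin n → ℤ,
      if (∑ i, k i) = 0 ∧
          ∀ i : Fin n, 0 ≤ (M1 : ℤ) + n * k i + (i : ℕ) ∧
            0 ≤ (M2 : ℤ) - n * k i + n - ((i : ℕ) + 1) then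
        q ^ ((((n + 1).choose 2 : ℕ) : ℤ) * (∑ i, (k i) ^ 2) +
              ∑ i : Fin n, (((i : ℕ) : ℤ) + 1) * k i) *
          (∏ j : Fin n, ∏ i ∈ Finset.univ.filter (fun i : Fin n => i < j),
            (1 - q ^ ((n : ℤ) * k j - (n : ℤ) * k i + ((j : ℕ) : ℤ) - ((i : ℕ) : ℤ)))) *
          ∏ i : Fin n,
            qPoch q q (M1 + M2 + (i : ℕ)) /
              (qPoch q q ((M1 : ℤ) + n * k i + (i : ℕ)).toNat *
                qPoch q q ((M2 : ℤ) - n * k i + n - ((i : ℕ) + 1)).toNat)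
      else 0) =
    qPoch q q (M1 + M2) / (qPoch q q M1 * qPoch q q M2) := by
  obtain ⟨m, rfl⟩ : ∃ m, n = m + 1 := ⟨n - 1, by omega⟩
  have hne : q ^ ((m + 1) * M1.choose 2) ≠ 0 := pow_ne_zero _ hq0
  apply mul_left_cancel₀ hne
  rw [← cylSum_qCoeff hq0 hq m M1 M2, cylSum, mul_finsum]
  refine finsum_congr fun k => ?_
  split_ifs with h
  · obtain ⟨hk, hpos⟩ := h
    refine Eq.trans ?_ (cylWeight_mul_det_qCoeff hq0 hq m M1 (M1 + M2) k hk
      (fun i => ((M1 : ℤ) + (m + 1 : ℕ) * k i + (i : ℕ)).toNat)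
      (fun i => ((M2 : ℤ) - (m + 1 : ℕ) * k i + (m + 1 : ℕ) - ((i : ℕ) + 1)).toNat)
      (fun i => Int.toNat_of_nonneg (hpos i).1) (fun i => ?_)).symm
    · congr 3
      refine prod_congr rfl fun j _ => prod_congr rfl fun i _ => ?_
      congr 2
      simp only [cylPos]
      ring
    · have h1 := Int.toNat_of_nonneg (hpos i).1
      have h2 := Int.toNat_of_nonneg (hpos i).2
      apply Nat.cast_injective (R := ℤ)
      rw [Nat.cast_add, h1, h2]
      push_cast
      ring
  · rw [mul_zero]
    by_cases hk : ∑ i, k i = 0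
    · have h' : ∃ i, cylPos M1 k i < 0 ∨ ((M1 + M2 : ℕ) + m : ℤ) < cylPos M1 k i := by
        by_contra! hcon
        refine h ⟨hk, fun i => ⟨(hcon i).1, ?_⟩⟩
        have := (hcon i).2
        simp only [cylPos] at this
        push_cast at this ⊢
        linarith
      obtain ⟨i, hi⟩ := h'
      rw [det_qCoeff_eq_zero hq0 hq m (M1 + M2) _ i hi, mul_zero]
    · rw [cylWeight, if_neg hk, zero_mul]
end

section
/- (Rotation trick.) Fix a positive integer n. Suppose that for all nonnegative integers M_1, M_2 the following identity holds: the sum over integer tuples (k_1,…,k_n) with k_1+⋯+k_n = 0 and M_1 + n·k_i + i - 1 ≥ 0 and M_2 - n·k_i + n - i ≥ 0 for all i, of q^{binom(n+1,2)·∑k_i² + ∑ i·k_i} · ∏_{1≤i<j≤n} (1 - q^{n·k_j - n·k_i + j - i}) · ∏_{i=1}^{n} (q;q)_{M_1+M_2+i-1} / ( (q;q)_{M_1+n·k_i+i-1} · (q;q)_{M_2-n·k_i+n-i} ), equals (q;q)_{M_1+M_2} / ( (q;q)_{M_1} · (q;q)_{M_2} ). Then for all nonnegative integers M_1, M_2 and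 every integer S with -M_1 ≤ S ≤ M_2, the sum over integer tuples (k_1,…,k_n) with k_1+⋯+k_n = S and M_1 + n·k_i + i - 1 ≥ 0 and M_2 - n·k_i + n - i ≥ 0 for all i, of (-1)^{(n-1)S} · q^{binom(n+1,2)·∑k_i² + ∑ i·k_i} · ∏_{1≤i<j≤n} (1 - q^{n·k_j - n·k_i + j - i}) · ∏_{i=1}^{n} (q;q)_{M_1+M_2+i-1} / ( (q;q)_{M_1+n·k_i+i-1} · (q;q)_{M_2-n·k_i+n-i} ), equals q^{(n+1)·binom(S+1,2)} · (q;q)_{M_1+M_2} / ( (q;q)_{M_1+S} · (q;q)_{M_2-S} ). -/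
open Finset

/-- The summand of Warnaar's formula, with integer parameters `a`, `b` in place of `M_1`, `M_2`
and with `N` in place of `M_1 + M_2`. -/
noncomputable def warnaarTerm {F : Type*} [Field F] (q : F) (n N : ℕ) (a b S : ℤ)
    (k : Fin n → ℤ) : F :=
  if (∑ i, k i) = S ∧
      ∀ i : Fin n, 0 ≤ a + n * k i + (i : ℕ) ∧ 0 ≤ b - n * k i + n - ((i : ℕ) + 1) then
    (-1 : F) ^ (((n : ℤ) - 1) * S) *
      q ^ ((((n + 1).choose 2 : ℕ) : ℤ) * (∑ i, (k i) ^ 2) +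
          ∑ i : Fin n, (((i : ℕ) : ℤ) + 1) * k i) *
      (∏ j : Fin n, ∏ i ∈ Finset.univ.filter (fun i : Fin n => i < j),
        (1 - q ^ ((n : ℤ) * k j - (n : ℤ) * k i + ((j : ℕ) : ℤ) - ((i : ℕ) : ℤ)))) *
      ∏ i : Fin n,
        qPoch q q (N + (i : ℕ)) /
          (qPoch q q (a + n * k i + (i : ℕ)).toNat *
            qPoch q q (b - n * k i + n - ((i : ℕ) + 1)).toNat)
  else 0

/-- The bijection `(k_1, …, k_n) ↦ (k_n + 1, k_1, …, k_{n-1})` of `ℤ^n`. -/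
def rotateEquiv (m : ℕ) : (Fin (m + 1) → ℤ) ≃ (Fin (m + 1) → ℤ) where
  toFun k := Fin.cons (k (Fin.last m) + 1) (Fin.init k)
  invFun k := Fin.snoc (Fin.tail k) (k 0 - 1)
  left_inv k := by simp
  right_inv k := by simp

theorem rotateEquiv_zero {m : ℕ} (k : Fin (m + 1) → ℤ) :
    rotateEquiv m k 0 = k (Fin.last m) + 1 := rfl

theorem rotateEquiv_succ {m : ℕ} (k : Fin (m + 1) → ℤ) (i : Fin m) :
    rotateEquiv m k i.succ = k i.castSucc := rfl

theorem sum_rotateEquiv {m : ℕ} (k : Fin (m + 1) → ℤ) :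
    ∑ i, rotateEquiv m k i = ∑ i, k i + 1 := by
  rw [Fin.sum_univ_succ, Fin.sum_univ_castSucc]
  simp only [rotateEquiv_zero, rotateEquiv_succ]
  ring

theorem prod_one_sub_zpow_neg {F ι : Type*} [Field F] {q : F} (hq0 : q ≠ 0) (s : Finset ι)
    (e : ι → ℤ) :
    ∏ i ∈ s, (1 - q ^ (-e i)) =
      (-1) ^ #s * q ^ (-∑ i ∈ s, e i) * ∏ i ∈ s, (1 - q ^ e i) := by
  classical
  induction s using Finset.induction_on with
  | empty => simp
  | insert a s ha ih =>
    rw [prod_insert ha, prod_insert ha, sum_insert ha, card_insert_of_notMem ha, ih, neg_add,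
      zpow_add₀ hq0, pow_succ]
    have h : q ^ (-e a) * q ^ e a = 1 := by rw [← zpow_add₀ hq0]; simp
    linear_combination (-1) ^ #s * q ^ (-∑ i ∈ s, e i) * (∏ i ∈ s, (1 - q ^ e i)) * (-h)

theorem two_mul_sum_fin_val (m : ℕ) : 2 * ∑ i : Fin m, ((i : ℕ) : ℤ) = m * (m - 1) := by
  induction m with
  | zero => simp
  | succ m ih =>
    rw [Fin.sum_univ_castSucc]
    simp only [Fin.val_castSucc, Fin.val_last]
    push_cast
    linarith

theorem two_mul_choose_two (m : ℕ) : 2 * (((m + 1).choose 2 : ℕ) : ℤ) = (m + 1) * m := by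
  have h := Nat.triangle_succ m
  rw [← Nat.choose_two_right] at h
  induction m with
  | zero => simp
  | succ m ih =>
    rw [Nat.choose_succ_succ' (m + 1) 1, Nat.choose_one_right]
    have := ih (by rw [Nat.choose_two_right, Nat.triangle_succ])
    push_cast at this ⊢
    linarith

/-- Rotation moves the last index to the front, so the `n - 1` factors involving it get inverted
exponents. -/
theorem vandermonde_rotateEquiv {F : Type*} [Field F] {q : F} (hq0 : q ≠ 0) (m : ℕ)
    (k : Fin (m + 1) → ℤ) :
    (∏ j : Fin (m + 1), ∏ i ∈ Finset.univ.filter (fun i : Fin (m + 1) => i < j),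
      (1 - q ^ (((m + 1 : ℕ) : ℤ) * rotateEquiv m k j - ((m + 1 : ℕ) : ℤ) * rotateEquiv m k i +
        ((j : ℕ) : ℤ) - ((i : ℕ) : ℤ)))) =
    (-1) ^ m * q ^ (-∑ i : Fin m, (((m + 1 : ℕ) : ℤ) * k (Fin.last m) -
        ((m + 1 : ℕ) : ℤ) * k i.castSucc + m - ((i : ℕ) : ℤ))) *
      ∏ j : Fin (m + 1), ∏ i ∈ Finset.univ.filter (fun i : Fin (m + 1) => i < j),
        (1 - q ^ (((m + 1 : ℕ) : ℤ) * k j - ((m + 1 : ℕ) : ℤ) * k i +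
          ((j : ℕ) : ℤ) - ((i : ℕ) : ℤ))) := by
  have key := prod_one_sub_zpow_neg hq0 (Finset.univ : Finset (Fin m))
    (fun i => ((m + 1 : ℕ) : ℤ) * k (Fin.last m) -
        ((m + 1 : ℕ) : ℤ) * k i.castSucc + m - ((i : ℕ) : ℤ))
  rw [card_univ, Fintype.card_fin] at key
  simp only [prod_filter]
  conv_lhs => simp only [Fin.prod_univ_succ (n := m), rotateEquiv_zero, rotateEquiv_succ]
  conv_rhs => simp only [Fin.prod_univ_castSucc (n := m)]
  simp only [Fin.not_lt_zero, if_false, prod_const_one, one_mul, mul_one, Fin.succ_pos, if_true,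
    Fin.succ_lt_succ_iff, Fin.castSucc_lt_castSucc_iff, Fin.castSucc_lt_last, lt_irrefl,
    Fin.val_succ, Fin.val_castSucc, Fin.val_last, Fin.val_zero, prod_mul_distrib,
    (Fin.castSucc_lt_last _).not_gt]
  rw [mul_comm (∏ j : Fin m, ∏ i : Fin m, _) (∏ i : Fin m, _), ← mul_assoc, ← key]
  congr 1
  · refine prod_congr rfl fun i _ => ?_
    congr 2
    push_cast
    ring
  · refine prod_congr rfl fun j _ => prod_congr rfl fun i _ => ?_
    congr 3
    push_cast
    ring

theorem warnaarTerm_rotateEquiv {F : Type*} [Field F] {q : F} (hq0 : q ≠ 0) (m N : ℕ)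
    (a b S : ℤ) (k : Fin (m + 1) → ℤ) :
    warnaarTerm q (m + 1) N a b (S + 1) (rotateEquiv m k) =
      q ^ (((m + 1 : ℕ) + 1 : ℤ) * (S + 1)) * warnaarTerm q (m + 1) N (a + 1) (b - 1) S k := by
  have h1 : ∀ x : ℤ, a + ((m + 1 : ℕ) : ℤ) * (x + 1) + ((0 : ℕ) : ℤ) =
      a + 1 + ((m + 1 : ℕ) : ℤ) * x + (m : ℤ) := fun x => by push_cast; ring
  have h2 : ∀ x y : ℤ, a + ((m + 1 : ℕ) : ℤ) * x + (y + 1) =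
      a + 1 + ((m + 1 : ℕ) : ℤ) * x + y := fun x y => by ring
  have h3 : ∀ x : ℤ, b - ((m + 1 : ℕ) : ℤ) * (x + 1) + ((m + 1 : ℕ) : ℤ) - (((0 : ℕ) : ℤ) + 1) =
      b - 1 - ((m + 1 : ℕ) : ℤ) * x + ((m + 1 : ℕ) : ℤ) - ((m : ℤ) + 1) :=
    fun x => by push_cast; ring
  have h4 : ∀ x y : ℤ, b - ((m + 1 : ℕ) : ℤ) * x + ((m + 1 : ℕ) : ℤ) - (y + 1 + 1) =
      b - 1 - ((m + 1 : ℕ) : ℤ) * x + ((m + 1 : ℕ) : ℤ) - (y + 1) := fun x y => by ring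
  unfold warnaarTerm
  rw [mul_ite, mul_zero]
  refine if_ctx_congr ?_ (fun hk => ?_) (fun _ => rfl)
  · rw [sum_rotateEquiv, add_left_inj, Fin.forall_fin_succ, Fin.forall_fin_succ']
    simp only [rotateEquiv_zero, rotateEquiv_succ, Fin.val_succ, Fin.val_castSucc, Fin.val_last,
      Fin.val_zero, Nat.cast_add_one (R := ℤ) (n := Fin.val _), h1, h2, h3, h4]
    tauto
  · have hP : (∏ i : Fin (m + 1), qPoch q q (N + (i : ℕ)) /
          (qPoch q q (a + (m + 1 : ℕ) * rotateEquiv m k i + (i : ℕ)).toNat *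
            qPoch q q (b - (m + 1 : ℕ) * rotateEquiv m k i + (m + 1 : ℕ) -
              ((i : ℕ) + 1)).toNat)) =
        ∏ i : Fin (m + 1), qPoch q q (N + (i : ℕ)) /
          (qPoch q q (a + 1 + (m + 1 : ℕ) * k i + (i : ℕ)).toNat *
            qPoch q q (b - 1 - (m + 1 : ℕ) * k i + (m + 1 : ℕ) - ((i : ℕ) + 1)).toNat) := by
      rw [prod_div_distrib, prod_div_distrib]
      congr 1
      rw [Fin.prod_univ_succ]
      conv_rhs => rw [Fin.prod_univ_castSucc]
      rw [mul_comm]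
      simp only [rotateEquiv_zero, rotateEquiv_succ, Fin.val_succ, Fin.val_castSucc, Fin.val_last,
        Fin.val_zero, Nat.cast_add_one (R := ℤ) (n := Fin.val _), h1, h2, h3, h4]
    rw [vandermonde_rotateEquiv hq0, hP]
    have hS : ∑ i : Fin m, k i.castSucc + k (Fin.last m) = S := by
      rw [← Fin.sum_univ_castSucc, hk.1]
    have hsign : (-1 : F) ^ ((((m + 1 : ℕ) : ℤ) - 1) * (S + 1)) * (-1) ^ m =
        (-1) ^ ((((m + 1 : ℕ) : ℤ) - 1) * S) := by
      have h : (((m + 1 : ℕ) : ℤ) - 1) * (S + 1) = (((m + 1 : ℕ) : ℤ) - 1) * S + m := by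
        push_cast
        ring
      rw [h, zpow_add₀ (by simp), zpow_natCast, mul_assoc, ← mul_pow]
      simp
    have hexp : q ^ ((((m + 1 + 1).choose 2 : ℕ) : ℤ) * (∑ i, (rotateEquiv m k i) ^ 2) +
          ∑ i : Fin (m + 1), (((i : ℕ) : ℤ) + 1) * rotateEquiv m k i) *
        q ^ (-∑ i : Fin m, (((m + 1 : ℕ) : ℤ) * k (Fin.last m) -
          ((m + 1 : ℕ) : ℤ) * k i.castSucc + m - ((i : ℕ) : ℤ))) =
        q ^ (((m + 1 : ℕ) + 1 : ℤ) * (S + 1)) *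
          q ^ ((((m + 1 + 1).choose 2 : ℕ) : ℤ) * (∑ i, (k i) ^ 2) +
            ∑ i : Fin (m + 1), (((i : ℕ) : ℤ) + 1) * k i) := by
      rw [← zpow_add₀ hq0, ← zpow_add₀ hq0]
      congr 1
      rw [Fin.sum_univ_succ, Fin.sum_univ_succ, Fin.sum_univ_castSucc (f := fun i => k i ^ 2),
        Fin.sum_univ_castSucc (f := fun i : Fin (m + 1) => (((i : ℕ) : ℤ) + 1) * k i)]
      simp only [rotateEquiv_zero, rotateEquiv_succ, Fin.val_succ, Fin.val_castSucc, Fin.val_last,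
        Fin.val_zero, add_mul, one_mul, sum_add_distrib, sum_sub_distrib, ← mul_sum, sum_const,
        card_univ, Fintype.card_fin, nsmul_eq_mul, Nat.cast_add, Nat.cast_one, Nat.cast_zero]
      have hc := two_mul_choose_two (m + 1)
      have hs := two_mul_sum_fin_val m
      push_cast at hc
      refine mul_left_cancel₀ (two_ne_zero (α := ℤ)) ?_
      linear_combination (2 * k (Fin.last m) + 1) * hc + hs + (2 * (m + 2)) * hS
    rw [← hsign]
    linear_combination (-1 : F) ^ ((((m + 1 : ℕ) : ℤ) - 1) * (S + 1)) * (-1) ^ m *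
      (∏ j : Fin (m + 1), ∏ i ∈ Finset.univ.filter (fun i : Fin (m + 1) => i < j),
        (1 - q ^ (((m + 1 : ℕ) : ℤ) * k j - ((m + 1 : ℕ) : ℤ) * k i +
          ((j : ℕ) : ℤ) - ((i : ℕ) : ℤ)))) *
      (∏ i : Fin (m + 1), qPoch q q (N + (i : ℕ)) /
          (qPoch q q (a + 1 + (m + 1 : ℕ) * k i + (i : ℕ)).toNat *
            qPoch q q (b - 1 - (m + 1 : ℕ) * k i + (m + 1 : ℕ) - ((i : ℕ) + 1)).toNat)) * hexp

theorem finsum_warnaarTerm_succ {F : Type*} [Field F] {q : F} (hq0 : q ≠ 0) {n : ℕ} (hn : 0 < n)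
    (N : ℕ) (a b S : ℤ) :
    ∑ᶠ k, warnaarTerm q n N a b (S + 1) k =
      q ^ (((n : ℤ) + 1) * (S + 1)) * ∑ᶠ k, warnaarTerm q n N (a + 1) (b - 1) S k := by
  obtain ⟨m, rfl⟩ := Nat.exists_eq_succ_of_ne_zero hn.ne'
  rw [← finsum_comp_equiv (rotateEquiv m), mul_finsum]
  exact finsum_congr fun k => warnaarTerm_rotateEquiv hq0 m N a b S k

theorem finsum_warnaarTerm_eq {F : Type*} [Field F] {q : F} (hq0 : q ≠ 0) {n : ℕ} (hn : 0 < n)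
    (N : ℕ) (a b S : ℤ) :
    ∑ᶠ k, warnaarTerm q n N a b S k =
      q ^ (((n : ℤ) + 1) * ((S + 1) * S / 2)) *
        ∑ᶠ k, warnaarTerm q n N (a + S) (b - S) 0 k := by
  have htri : ∀ T : ℤ, (T + 1 + 1) * (T + 1) / 2 = T + 1 + (T + 1) * T / 2 := fun T => by
    rw [show (T + 1 + 1) * (T + 1) = (T + 1) * T + (T + 1) * 2 by ring,
      Int.add_mul_ediv_right _ _ two_ne_zero, add_comm]
  induction S using Int.induction_on generalizing a b with
  | zero => simp
  | succ S ih =>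
    rw [finsum_warnaarTerm_succ hq0 hn, ih, htri, mul_add ((n : ℤ) + 1) (S + 1 : ℤ), zpow_add₀ hq0,
      mul_assoc, add_assoc a, add_comm 1 (S : ℤ), sub_sub, add_comm 1 (S : ℤ)]
  | pred S ih =>
    have h := finsum_warnaarTerm_succ hq0 hn N (a - 1) (b + 1) (-(S : ℤ) - 1)
    have ht := htri (-(S : ℤ) - 1)
    rw [sub_add_cancel] at h ht
    rw [sub_add_cancel, add_sub_cancel_right, ih, ht, mul_add ((n : ℤ) + 1), zpow_add₀ hq0,
      mul_assoc] at h
    rw [← mul_left_cancel₀ (zpow_ne_zero _ hq0) h, sub_add_cancel,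
      show a - 1 + -(S : ℤ) = a + (-S - 1) by ring, show b + 1 - -(S : ℤ) = b - (-S - 1) by ring]

/-- The "rotation trick": the case `S = 0` of Warnaar's summation formula (for all
`M_1, M_2`) implies the general case. Here `(S+1)*S/2` is the binomial coefficient
`binom(S+1,2)`. -/
theorem rotation_trick {F : Type*} [Field F] (q : F) (hq0 : q ≠ 0)
    (hq : ∀ m : ℕ, 0 < m → q ^ m ≠ 1)
    (n : ℕ) (hn : 0 < n)
    (h0 : ∀ M1 M2 : ℕ,
      (∑ᶠ k : Fin n → ℤ,
        if (∑ i, k i) = 0 ∧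
            ∀ i : Fin n, 0 ≤ (M1 : ℤ) + n * k i + (i : ℕ) ∧
              0 ≤ (M2 : ℤ) - n * k i + n - ((i : ℕ) + 1) then
          q ^ ((((n + 1).choose 2 : ℕ) : ℤ) * (∑ i, (k i) ^ 2) +
                ∑ i : Fin n, (((i : ℕ) : ℤ) + 1) * k i) *
            (∏ j : Fin n, ∏ i ∈ Finset.univ.filter (fun i : Fin n => i < j),
              (1 - q ^ ((n : ℤ) * k j - (n : ℤ) * k i + ((j : ℕ) : ℤ) - ((i : ℕ) : ℤ)))) *
            ∏ i : Fin n,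
              qPoch q q (M1 + M2 + (i : ℕ)) /
                (qPoch q q ((M1 : ℤ) + n * k i + (i : ℕ)).toNat *
                  qPoch q q ((M2 : ℤ) - n * k i + n - ((i : ℕ) + 1)).toNat)
        else 0) =
      qPoch q q (M1 + M2) / (qPoch q q M1 * qPoch q q M2)) :
    ∀ (M1 M2 : ℕ) (S : ℤ), -(M1 : ℤ) ≤ S → S ≤ (M2 : ℤ) →
      (∑ᶠ k : Fin n → ℤ,
        if (∑ i, k i) = S ∧
            ∀ i : Fin n, 0 ≤ (M1 : ℤ) + n * k i + (i : ℕ) ∧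
              0 ≤ (M2 : ℤ) - n * k i + n - ((i : ℕ) + 1) then
          (-1 : F) ^ (((n : ℤ) - 1) * S) *
            q ^ ((((n + 1).choose 2 : ℕ) : ℤ) * (∑ i, (k i) ^ 2) +
                ∑ i : Fin n, (((i : ℕ) : ℤ) + 1) * k i) *
            (∏ j : Fin n, ∏ i ∈ Finset.univ.filter (fun i : Fin n => i < j),
              (1 - q ^ ((n : ℤ) * k j - (n : ℤ) * k i + ((j : ℕ) : ℤ) - ((i : ℕ) : ℤ)))) *
            ∏ i : Fin n,
              qPoch q q (M1 + M2 + (i : ℕ)) /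
                (qPoch q q ((M1 : ℤ) + n * k i + (i : ℕ)).toNat *
                  qPoch q q ((M2 : ℤ) - n * k i + n - ((i : ℕ) + 1)).toNat)
        else 0) =
      q ^ (((n : ℤ) + 1) * ((S + 1) * S / 2)) *
        qPoch q q (M1 + M2) /
          (qPoch q q ((M1 : ℤ) + S).toNat * qPoch q q ((M2 : ℤ) - S).toNat) := by
  intro M1 M2 S hS1 hS2
  refine (finsum_warnaarTerm_eq hq0 hn (M1 + M2) M1 M2 S).trans ?_
  obtain ⟨A, hA⟩ := Int.eq_ofNat_of_zero_le (show 0 ≤ (M1 : ℤ) + S by omega)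
  obtain ⟨B, hB⟩ := Int.eq_ofNat_of_zero_le (show 0 ≤ (M2 : ℤ) - S by omega)
  have h := h0 A B
  have hAB : A + B = M1 + M2 := by omega
  rw [hA, hB, Int.toNat_natCast, Int.toNat_natCast, mul_div_assoc, ← hAB, ← h]
  congr 1
  refine finsum_congr fun k => ?_
  simp only [warnaarTerm, mul_zero, zpow_zero, one_mul]
end

section
/- (Reduction modulo n via polynomiality.) Fix a positive integer n and a nonnegative integer M_2. For a nonnegative integer M_1, let I(M_1) denote the assertion that the sum over integer tuples (k_1,…,k_n) with k_1+⋯+k_n = 0 and M_2 - n·k_i + n - i ≥ 0 for all i, of q^{binom(n+1,2)·∑k_i² + ∑ i·k_i} · ∏_{1≤i<j≤n} (1 - q^{n·k_j - n·k_i + j - i}) · ∏_{i=1}^{n} (q^{M_1+n·k_i+i};q)_{M_2-n·k_i+n} / (q;q)_{M_2-n·k_i+n-i}, equals (q^{M_1+1};q)_{M_2} / (q;q)_{M_2} · ∏_{i=1}^{n} (q^{M_1+M_2+i};q)_n. If I(M_1) holds for every nonnegative integer M_1 divisible by n, then I(M_1) holds for every nonnegative integer M_1. -/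
open Finset

/-- The assertion `I(M_1)`: the polynomial form (in `q^{M_1}`) of the `S = 0` case of
Warnaar's summation formula, for fixed `n` and `M_2`. -/
def WarnaarPolyId {F : Type*} [Field F] (q : F) (n M2 M1 : ℕ) : Prop :=
  (∑ᶠ k : Fin n → ℤ,
    if (∑ i, k i) = 0 ∧
        ∀ i : Fin n, 0 ≤ (M2 : ℤ) - n * k i + n - ((i : ℕ) + 1) then
      q ^ ((((n + 1).choose 2 : ℕ) : ℤ) * (∑ i, (k i) ^ 2) +
            ∑ i : Fin n, (((i : ℕ) : ℤ) + 1) * k i) *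
        (∏ j : Fin n, ∏ i ∈ Finset.univ.filter (fun i : Fin n => i < j),
          (1 - q ^ ((n : ℤ) * k j - (n : ℤ) * k i + ((j : ℕ) : ℤ) - ((i : ℕ) : ℤ)))) *
        ∏ i : Fin n,
          qPoch q (q ^ ((M1 : ℤ) + n * k i + ((i : ℕ) + 1)))
              (((M2 : ℤ) - n * k i + n).toNat) /
            qPoch q q ((M2 : ℤ) - n * k i + n - ((i : ℕ) + 1)).toNat
    else 0) =
  qPoch q (q ^ (M1 + 1)) M2 / qPoch q q M2 *
    ∏ i : Fin n, qPoch q (q ^ (M1 + M2 + (i : ℕ) + 1)) n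

/-- Functions of `M` that are polynomial in `q ^ M`. -/
abbrev polyInPow {F : Type*} [Field F] (q : F) : Subalgebra F (ℕ → F) :=
  Algebra.adjoin F {fun M : ℕ => q ^ M}

/-- Two polynomials in `q ^ M` that agree at all multiples `M` of `n > 0` agree everywhere. -/
theorem eq_of_mem_polyInPow {F : Type*} [Field F] {q : F} (hq0 : q ≠ 0)
    (hq : ∀ m : ℕ, 0 < m → q ^ m ≠ 1) {n : ℕ} (hn : 0 < n) {f g : ℕ → F}
    (hf : f ∈ polyInPow q) (hg : g ∈ polyInPow q) (h : ∀ M, n ∣ M → f M = g M) : f = g := by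
  have hfg := sub_mem hf hg
  rw [polyInPow, Algebra.adjoin_singleton_eq_range_aeval] at hfg
  obtain ⟨p, hp : Polynomial.aeval (fun M : ℕ => q ^ M) p = f - g⟩ := hfg
  have eval_eq (M : ℕ) : p.eval (q ^ M) = f M - g M := by
    have hM := congrArg (Pi.evalAlgHom F (fun _ : ℕ => F) M) hp
    rw [← Polynomial.aeval_algHom_apply] at hM
    simpa using hM
  have hord : orderOf q = 0 := orderOf_eq_zero_iff'.2 hq
  have hinj : Function.Injective fun m : ℕ => q ^ (n * m) := by
    intro a b hab
    have hab' : q ^ (n * a) = q ^ (n * b) := hab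
    rw [← Units.val_mk0 hq0, ← Units.val_pow_eq_pow_val, ← Units.val_pow_eq_pow_val,
      Units.val_inj, pow_inj_iff_of_orderOf_eq_zero
        (by rwa [← orderOf_units, Units.val_mk0])] at hab'
    exact Nat.eq_of_mul_eq_mul_left hn hab'
  have hp0 : p = 0 := by
    refine Polynomial.eq_zero_of_infinite_isRoot p
      ((Set.infinite_range_of_injective hinj).mono ?_)
    rintro _ ⟨m, rfl⟩
    simp [Polynomial.IsRoot, eval_eq, h _ (dvd_mul_right n m)]
  funext M
  simpa [hp0, sub_eq_zero, eq_comm] using eval_eq M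

theorem const_mem_polyInPow {F : Type*} [Field F] (q c : F) :
    (fun _ : ℕ => c) ∈ polyInPow q :=
  (polyInPow q).algebraMap_mem c

theorem qPoch_mem_polyInPow {F : Type*} [Field F] (q c : F) (k : ℕ) :
    (fun M : ℕ => qPoch q (q ^ M * c) k) ∈ polyInPow q := by
  have heq : (fun M : ℕ => qPoch q (q ^ M * c) k) =
      ∏ j ∈ range k, (1 - (fun M : ℕ => q ^ M) * fun _ => c * q ^ j) := by
    funext M
    simp [qPoch, mul_assoc]
  rw [heq]
  exact prod_mem fun j _ => sub_mem (one_mem _)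
    (mul_mem (Algebra.self_mem_adjoin_singleton F _) (const_mem_polyInPow q _))

/-- The index set of the sum in `WarnaarPolyId` lies in a box. -/
theorem mem_piFinset_of_sum_eq_zero {n M2 : ℕ} {k : Fin n → ℤ} (hsum : ∑ i, k i = 0)
    (hk : ∀ i : Fin n, 0 ≤ (M2 : ℤ) - n * k i + n - ((i : ℕ) + 1)) :
    k ∈ Fintype.piFinset fun _ : Fin n => Icc (-(n * (M2 + 1) : ℤ)) (M2 + 1) := by
  have upper (i : Fin n) : k i ≤ M2 + 1 := by
    by_contra! hlt
    have hn : (1 : ℤ) ≤ n := by exact_mod_cast i.pos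
    nlinarith [hk i]
  refine Fintype.mem_piFinset.2 fun i => mem_Icc.2 ⟨?_, upper i⟩
  have hle : ∑ j ∈ univ.erase i, k j ≤ ∑ _j : Fin n, ((M2 : ℤ) + 1) :=
    (sum_le_sum fun j _ => upper j).trans
      (sum_le_sum_of_subset_of_nonneg (erase_subset _ _) fun _ _ _ => by positivity)
  rw [← add_sum_erase univ k (mem_univ i)] at hsum
  simp only [sum_const, card_univ, Fintype.card_fin, nsmul_eq_mul] at hle
  linarith

/-- Reduction modulo `n` via polynomiality: if the identity `I(M_1)` holds for all
`M_1` divisible by `n`, then it holds for all nonnegative integers `M_1`. -/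
theorem warnaar_reduction_mod_n {F : Type*} [Field F] (q : F) (hq0 : q ≠ 0)
    (hq : ∀ m : ℕ, 0 < m → q ^ m ≠ 1)
    (n : ℕ) (hn : 0 < n) (M2 : ℕ)
    (h : ∀ M1 : ℕ, n ∣ M1 → WarnaarPolyId q n M2 M1) :
    ∀ M1 : ℕ, WarnaarPolyId q n M2 M1 := by
  refine fun M1 => congrFun (eq_of_mem_polyInPow hq0 hq hn (f := fun M1 => finsum _)
    (g := fun M1 => qPoch q (q ^ (M1 + 1)) M2 / qPoch q q M2 *
      ∏ i : Fin n, qPoch q (q ^ (M1 + M2 + (i : ℕ) + 1)) n) ?_ ?_ h) M1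
  · rw [show (fun M1 : ℕ => finsum _) = _ from funext fun M1 =>
      finsum_eq_sum_of_support_subset (s := Fintype.piFinset fun _ : Fin n =>
        Icc (-(n * (M2 + 1) : ℤ)) (M2 + 1)) _ fun k hk => ?_]
    · rw [← sum_fn]
      refine sum_mem fun k _ => ?_
      split_ifs
      · refine mul_mem (const_mem_polyInPow q _) ?_
        rw [← prod_fn]
        refine prod_mem fun i _ => ?_
        simp_rw [add_assoc, zpow_add₀ hq0 (_ : ℕ), zpow_natCast, div_eq_mul_inv]
        exact mul_mem (qPoch_mem_polyInPow q _ _) (const_mem_polyInPow q _)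
      · exact zero_mem _
    · by_contra hmem
      refine hk (if_neg fun hc => hmem ?_)
      exact mem_coe.2 (mem_piFinset_of_sum_eq_zero hc.1 hc.2)
  · simp_rw [add_assoc, pow_add q (_ : ℕ), div_eq_mul_inv]
    refine mul_mem (mul_mem (qPoch_mem_polyInPow q _ _) (const_mem_polyInPow q _)) ?_
    rw [← prod_fn]
    exact prod_mem fun i _ => qPoch_mem_polyInPow q _ _
end
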